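/- There does not exist a polynomial F in two variables with rational coefficients of total degree 4 such that the set of values F(x,y), as (x,y) ranges over all pairs of integers, equals exactly the set of non-negative integers. -/

import Mathlib

/-- `f` takes few small values on `S`. -/
def Thin (f : ℤ → ℤ → ℝ) (S : ℤ → ℤ → Prop) : Prop :=
  ∃ C : ℝ, ∀ M : ℕ, 1 ≤ M → ∃ T : Finset ℝ, (T.card : ℝ) ≤ C * (M : ℝ) ^ 3 ∧
    ∀ x y, S x y → f x y ≤ (M : ℝ) ^ 4 → f x y ∈ T

theorem Thin.mono {f : ℤ → ℤ → ℝ} {S S' : ℤ → ℤ → Prop} (h : Thin f S)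
    (hs : ∀ x y, S' x y → S x y) : Thin f S' := by
  obtain ⟨C, hC⟩ := h
  refine ⟨C, fun M hM => ?_⟩
  obtain ⟨T, hT, h⟩ := hC M hM
  exact ⟨T, hT, fun x y hxy => h x y (hs x y hxy)⟩

theorem Thin.or {f : ℤ → ℤ → ℝ} {S S' : ℤ → ℤ → Prop} (h : Thin f S) (h' : Thin f S') :
    Thin f (fun x y => S x y ∨ S' x y) := by
  classical
  obtain ⟨C, hC⟩ := h
  obtain ⟨C', hC'⟩ := h'
  refine ⟨C + C', fun M hM => ?_⟩
  obtain ⟨T, hT, h⟩ := hC M hM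
  obtain ⟨T', hT', h'⟩ := hC' M hM
  refine ⟨T ∪ T', ?_, ?_⟩
  · have : ((T ∪ T').card : ℝ) ≤ T.card + T'.card := by exact_mod_cast Finset.card_union_le T T'
    nlinarith
  · rintro x y (hs | hs) hf
    · exact Finset.mem_union_left _ (h x y hs hf)
    · exact Finset.mem_union_right _ (h' x y hs hf)

theorem Thin.empty {f : ℤ → ℤ → ℝ} : Thin f (fun _ _ => False) :=
  ⟨0, fun M _ => ⟨∅, by simp, fun x y h => h.elim⟩⟩

theorem Thin.finset {f : ℤ → ℤ → ℝ} (s : Finset ℤ) (S : ℤ → ℤ → ℤ → Prop)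
    (h : ∀ k ∈ s, Thin f (S k)) : Thin f (fun x y => ∃ k ∈ s, S k x y) := by
  classical
  induction s using Finset.induction_on with
  | empty => exact Thin.empty.mono (by simp)
  | insert a s ha ih =>
    refine ((h a (by simp)).or (ih fun k hk => h k (by simp [hk]))).mono ?_
    rintro x y ⟨k, hk, hS⟩
    rcases Finset.mem_insert.1 hk with rfl | hk
    · exact Or.inl hS
    · exact Or.inr ⟨k, hk, hS⟩

theorem Thin.contra {f : ℤ → ℤ → ℝ} (h : Thin f (fun _ _ => True))
    (hf : ∀ n : ℕ, ∃ x y, f x y = n) : False := by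
  classical
  obtain ⟨C, hC⟩ := h
  obtain ⟨M, hM⟩ := exists_nat_gt (max C 1)
  have h1 : (1 : ℝ) < M := lt_of_le_of_lt (le_max_right _ _) hM
  have h2 : C < M := lt_of_le_of_lt (le_max_left _ _) hM
  obtain ⟨T, hT, h⟩ := hC M (by exact_mod_cast h1.le)
  have hsub : (Finset.range (M ^ 4)).image (fun n : ℕ => (n : ℝ)) ⊆ T := by
    intro v hv
    obtain ⟨n, hn, rfl⟩ := Finset.mem_image.1 hv
    obtain ⟨x, y, hxy⟩ := hf n
    rw [← hxy]
    refine h x y trivial ?_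
    rw [hxy]
    exact_mod_cast (Finset.mem_range.1 hn).le
  have hc := Finset.card_le_card hsub
  rw [Finset.card_image_of_injective _ Nat.cast_injective, Finset.card_range] at hc
  have hc' : (M : ℝ) ^ 4 ≤ T.card := by exact_mod_cast hc
  have : (0 : ℝ) < (M : ℝ) ^ 3 := by positivity
  nlinarith

theorem Thin.box {f : ℤ → ℤ → ℝ} {S : ℤ → ℤ → Prop} (i j : ℤ → ℤ → ℤ) (φ : ℤ → ℤ → ℝ) (C : ℝ)
    (hφ : ∀ x y, S x y → f x y = φ (i x y) (j x y))
    (hb : ∀ M : ℝ, 1 ≤ M → ∀ x y, S x y → f x y ≤ M ^ 4 →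
      (|(i x y : ℝ)| ≤ C * M ^ 2 ∧ |(j x y : ℝ)| ≤ C * M) ∨
      (|(i x y : ℝ)| ≤ C * M ∧ |(j x y : ℝ)| ≤ C * M ^ 2)) : Thin f S := by
  classical
  obtain ⟨K, hK⟩ := exists_nat_ge (max C 1)
  have hK1 : (1 : ℝ) ≤ K := le_trans (le_max_right _ _) hK
  have hKC : C ≤ K := le_trans (le_max_left _ _) hK
  have hK1' : 1 ≤ K := by exact_mod_cast hK1
  refine ⟨18 * K ^ 2, fun M hM => ?_⟩
  let I : ℕ → Finset ℤ := fun n => Finset.Icc (-(n : ℤ)) n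
  have hI : ∀ n : ℕ, (I n).card = 2 * n + 1 := by
    intro n; simp [I]; omega
  have hmem : ∀ (n : ℕ) (z : ℤ), |(z : ℝ)| ≤ n → z ∈ I n := by
    intro n z hz
    have : |z| ≤ n := by exact_mod_cast hz
    simp only [I, Finset.mem_Icc]
    exact abs_le.1 this
  refine ⟨((I (K * M ^ 2)) ×ˢ (I (K * M)) ∪ (I (K * M)) ×ˢ (I (K * M ^ 2))).image
    (fun p => φ p.1 p.2), ?_, ?_⟩
  · have h1 := Finset.card_image_le (s := ((I (K * M ^ 2)) ×ˢ (I (K * M)) ∪ (I (K * M)) ×ˢ (I (K * M ^ 2)))) (f := (fun p => φ p.1 p.2))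
    have h2 := Finset.card_union_le ((I (K * M ^ 2)) ×ˢ (I (K * M))) ((I (K * M)) ×ˢ (I (K * M ^ 2)))
    rw [Finset.card_product, Finset.card_product, hI, hI] at h2
    have h3 : (2 * (K * M ^ 2) + 1) ≤ 3 * (K * M ^ 2) := by
      have : 1 ≤ K * M ^ 2 := Nat.mul_pos hK1' (by positivity)
      omega
    have h4 : (2 * (K * M) + 1) ≤ 3 * (K * M) := by
      have : 1 ≤ K * M := Nat.mul_pos hK1' hM
      omega
    have h5 := Nat.mul_le_mul h3 h4
    have h6 := (h1.trans h2)
    have h7 : (2 * (K * M) + 1) * (2 * (K * M ^ 2) + 1) = (2 * (K * M ^ 2) + 1) * (2 * (K * M) + 1) := mul_comm _ _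
    rw [h7] at h6
    have h8 : (((I (K * M ^ 2)) ×ˢ (I (K * M)) ∪ (I (K * M)) ×ˢ (I (K * M ^ 2))).image
      (fun p => φ p.1 p.2)).card ≤ 18 * K ^ 2 * M ^ 3 := by
      calc _ ≤ _ := h6
        _ ≤ 3 * (K * M ^ 2) * (3 * (K * M)) + 3 * (K * M ^ 2) * (3 * (K * M)) := by omega
        _ = _ := by ring
    exact_mod_cast h8
  · intro x y hS hle
    rw [hφ x y hS]
    refine Finset.mem_image.2 ⟨(i x y, j x y), ?_, rfl⟩
    have hM1 : (1 : ℝ) ≤ M := by exact_mod_cast hM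
    have e1 : C * (M : ℝ) ≤ ((K * M : ℕ) : ℝ) := by push_cast; gcongr
    have e2 : C * (M : ℝ) ^ 2 ≤ ((K * M ^ 2 : ℕ) : ℝ) := by push_cast; gcongr
    rcases hb M hM1 x y hS hle with ⟨h1, h2⟩ | ⟨h1, h2⟩
    · exact Finset.mem_union_left _ (Finset.mem_product.2 ⟨hmem _ _ (h1.trans e2), hmem _ _ (h2.trans e1)⟩)
    · exact Finset.mem_union_right _ (Finset.mem_product.2 ⟨hmem _ _ (h1.trans e1), hmem _ _ (h2.trans e2)⟩)

theorem lead3 {A B C D E G H : ℝ} (h : ∀ R : ℝ, ∃ t > R, 0 ≤ A * t ^ 3 + B * t ^ 2 + C * t + D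
    + E * t⁻¹ + G * t⁻¹ ^ 2 + H * t⁻¹ ^ 3) : 0 ≤ A := by
  by_contra hA
  push Not at hA
  set Z := |B| + |C| + |D| + |E| + |G| + |H| with hZ
  obtain ⟨t, ht, h0⟩ := h (max 1 (Z / (-A)))
  have ht1 : 1 < t := lt_of_le_of_lt (le_max_left _ _) ht
  have ht2 : Z / (-A) < t := lt_of_le_of_lt (le_max_right _ _) ht
  rw [div_lt_iff₀ (by linarith)] at ht2
  have ht0 : 0 < t := by linarith
  have hi0 : 0 ≤ t⁻¹ := by positivity
  have hi1 : t⁻¹ ≤ 1 := inv_le_one_of_one_le₀ ht1.le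
  have ht3 : 1 ≤ t ^ 2 := one_le_pow₀ ht1.le
  have key : ∀ (a u : ℝ), 0 ≤ u → u ≤ t ^ 2 → a * u ≤ |a| * t ^ 2 := fun a u h1 h2 =>
    (mul_le_mul_of_nonneg_right (le_abs_self a) h1).trans
      (mul_le_mul_of_nonneg_left h2 (abs_nonneg a))
  have b1 := key B (t ^ 2) (by positivity) le_rfl
  have b2 := key C t ht0.le (by nlinarith)
  have b3 := key D 1 zero_le_one ht3
  have b4 := key E t⁻¹ hi0 (hi1.trans ht3)
  have b5 := key G (t⁻¹ ^ 2) (by positivity) ((pow_le_one₀ hi0 hi1).trans ht3)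
  have b6 := key H (t⁻¹ ^ 3) (by positivity) ((pow_le_one₀ hi0 hi1).trans ht3)
  have : A * t ^ 3 + Z * t ^ 2 < 0 := by
    have : A * t ^ 3 + Z * t ^ 2 = (A * t + Z) * t ^ 2 := by ring
    rw [this]
    exact mul_neg_of_neg_of_pos (by linarith) (by positivity)
  rw [hZ] at this
  linarith

/-- polynomial bounded below on the integers -/
theorem poly4 {p4 p3 p2 p1 p0 B : ℝ}
    (h : ∀ t : ℤ, B ≤ p4 * t ^ 4 + p3 * t ^ 3 + p2 * t ^ 2 + p1 * t + p0) :
    0 ≤ p4 ∧ (p4 = 0 → p3 = 0 ∧ 0 ≤ p2 ∧ (p2 = 0 → p1 = 0)) := by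
  have pos : ∀ R : ℝ, ∃ t : ℤ, (t : ℝ) > max R 0 := fun R => by
    obtain ⟨n, hn⟩ := exists_nat_gt (max R 0)
    exact ⟨n, by exact_mod_cast hn⟩
  refine ⟨?_, ?_⟩
  · refine lead3 (A := p4) (B := p3) (C := p2) (D := p1) (E := p0 - B) (G := 0) (H := 0) fun R => ?_
    obtain ⟨t, ht⟩ := pos R
    refine ⟨t, lt_of_le_of_lt (le_max_left _ _) ht, ?_⟩
    have h0 : (0 : ℝ) < t := lt_of_le_of_lt (le_max_right _ _) ht
    have := h t
    have e : p4 * (t : ℝ) ^ 3 + p3 * t ^ 2 + p2 * t + p1 + (p0 - B) * (t : ℝ)⁻¹ + 0 * (t : ℝ)⁻¹ ^ 2 + 0 * (t : ℝ)⁻¹ ^ 3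
      = (p4 * (t : ℝ) ^ 4 + p3 * t ^ 3 + p2 * t ^ 2 + p1 * t + p0 - B) / t := by field_simp; ring
    rw [e]
    apply div_nonneg _ h0.le; linarith
  · rintro rfl
    have hp3 : p3 = 0 := by
      apply le_antisymm
      · have : 0 ≤ -p3 := by
          refine lead3 (A := -p3) (B := p2) (C := -p1) (D := p0 - B) (E := 0) (G := 0) (H := 0) fun R => ?_
          obtain ⟨t, ht⟩ := pos R
          refine ⟨t, lt_of_le_of_lt (le_max_left _ _) ht, ?_⟩
          have := h (-t)
          push_cast at this
          linarith
        linarith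
      · refine lead3 (A := p3) (B := p2) (C := p1) (D := p0 - B) (E := 0) (G := 0) (H := 0) fun R => ?_
        obtain ⟨t, ht⟩ := pos R
        refine ⟨t, lt_of_le_of_lt (le_max_left _ _) ht, ?_⟩
        have := h t
        linarith
    subst hp3
    refine ⟨rfl, ?_, ?_⟩
    · refine lead3 (A := p2) (B := p1) (C := p0 - B) (D := 0) (E := 0) (G := 0) (H := 0) fun R => ?_
      obtain ⟨t, ht⟩ := pos R
      refine ⟨t, lt_of_le_of_lt (le_max_left _ _) ht, ?_⟩
      have h0 : (0 : ℝ) < t := lt_of_le_of_lt (le_max_right _ _) ht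
      have := h t
      have := mul_nonneg (sub_nonneg.2 this) h0.le
      nlinarith
    · rintro rfl
      apply le_antisymm
      · have : 0 ≤ -p1 := by
          refine lead3 (A := -p1) (B := p0 - B) (C := 0) (D := 0) (E := 0) (G := 0) (H := 0) fun R => ?_
          obtain ⟨t, ht⟩ := pos R
          refine ⟨t, lt_of_le_of_lt (le_max_left _ _) ht, ?_⟩
          have := h (-t)
          push_cast at this
          have := mul_nonneg (sub_nonneg.2 this) (sq_nonneg (t : ℝ))
          linarith
        linarith
      · refine lead3 (A := p1) (B := p0 - B) (C := 0) (D := 0) (E := 0) (G := 0) (H := 0) fun R => ?_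
        obtain ⟨t, ht⟩ := pos R
        refine ⟨t, lt_of_le_of_lt (le_max_left _ _) ht, ?_⟩
        have := h t
        have := mul_nonneg (sub_nonneg.2 this) (sq_nonneg (t : ℝ))
        linarith

theorem root2 {k r M : ℝ} (hk : 0 < k) (hM : 1 ≤ M) (_hr : 0 ≤ r) (h : k * r ^ 2 ≤ M ^ 4) :
    r ≤ (1 + 1 / k) * M ^ 2 := by
  by_contra hlt
  push Not at hlt
  have h1 : 0 < 1 / k := by positivity
  have h2 : 0 < M ^ 2 := by positivity
  have h3 : ((1 + 1 / k) * M ^ 2) ^ 2 < r ^ 2 := pow_lt_pow_left₀ hlt (by positivity) (by norm_num)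
  have h4 : k * ((1 + 1 / k) * M ^ 2) ^ 2 = (k + 2 + 1 / k) * M ^ 4 := by field_simp; ring
  have h5 : k * ((1 + 1 / k) * M ^ 2) ^ 2 < k * r ^ 2 := mul_lt_mul_of_pos_left h3 hk
  have h6 : 0 < M ^ 4 := by positivity
  nlinarith

theorem root4 {k r M : ℝ} (hk : 0 < k) (hM : 1 ≤ M) (_hr : 0 ≤ r) (h : k * r ^ 4 ≤ M ^ 4) :
    r ≤ (1 + 1 / k) * M := by
  by_contra hlt
  push Not at hlt
  have h1 : 0 < 1 / k := by positivity
  have h3 : ((1 + 1 / k) * M) ^ 4 < r ^ 4 := pow_lt_pow_left₀ hlt (by positivity) (by norm_num)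
  have h4 : 1 + 1 / k ≤ (1 + 1 / k) ^ 4 := le_self_pow₀ (by linarith) (by norm_num)
  have h6 : 0 < M ^ 4 := by positivity
  have h7 : k * (1 + 1 / k) = k + 1 := by field_simp
  have h5 : k * ((1 + 1 / k) * M) ^ 4 < k * r ^ 4 := mul_lt_mul_of_pos_left h3 hk
  have h8 : (k + 1) * M ^ 4 ≤ k * ((1 + 1 / k) * M) ^ 4 := by
    rw [← h7, mul_pow]
    have := mul_le_mul_of_nonneg_right (mul_le_mul_of_nonneg_left h4 hk.le) h6.le
    linarith
  nlinarith

theorem le_sq_of_one_le {C M r : ℝ} (hC : 0 ≤ C) (hM : 1 ≤ M) (h : r ≤ C * M) : r ≤ C * M ^ 2 :=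
  h.trans (mul_le_mul_of_nonneg_left (by nlinarith) hC)

theorem Thin.quad {f : ℤ → ℤ → ℝ} {S : ℤ → ℤ → Prop} (t : ℤ → ℤ → ℤ) (A B C : ℝ)
    (hf : ∀ x y, S x y → f x y = A * (t x y : ℝ) ^ 2 + B * t x y + C)
    (hA : 0 ≤ A) (hB : A = 0 → B = 0) : Thin f S := by
  rcases hA.eq_or_lt with hA | hA
  · have hB := hB hA.symm
    subst hB; subst hA
    refine Thin.box (fun _ _ => 0) (fun _ _ => 0) (fun _ _ => C) 0 (fun x y h => ?_) ?_
    · rw [hf x y h]; ring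
    · intro M hM x y _ _; left; simp
  · set L := |B| + |C|
    set R := 1 + 2 * L / A
    set K := (1 + 1 / (A / 2))
    have hL : 0 ≤ L := by positivity
    have hK0 : 0 ≤ K := by positivity
    have hR0 : 0 ≤ R := by positivity
    refine Thin.box t (fun _ _ => 0) (fun i _ => A * (i : ℝ) ^ 2 + B * i + C) (R + K) hf ?_
    intro M hM x y hS hle
    left
    refine ⟨?_, by simp; positivity⟩
    rw [hf x y hS] at hle
    set u := (t x y : ℝ)
    rcases le_total |u| R with h | h
    · have : (1 : ℝ) ≤ M ^ 2 := one_le_pow₀ hM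
      nlinarith
    · have hb : |u| ≤ K * M ^ 2 := by
        apply root2 (by positivity) hM (abs_nonneg u)
        have h1 : 1 ≤ |u| := le_trans (by simp [R]; positivity) h
        have h2 : 2 * L ≤ A * |u| := by
          have : 2 * L / A ≤ |u| := by simp only [R] at h; linarith
          rw [div_le_iff₀ hA] at this
          linarith
        have h3 : -(|B| * |u|) ≤ B * u := by rw [← abs_mul]; exact neg_abs_le _
        have h4 : -|C| ≤ C := neg_abs_le C
        have h5 : |C| ≤ |C| * |u| := le_mul_of_one_le_right (abs_nonneg C) h1
        have h6 : 2 * L * |u| ≤ A * |u| * |u| := mul_le_mul_of_nonneg_right h2 (abs_nonneg u)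
        have h7 : |u| ^ 2 = u ^ 2 := sq_abs u
        have h8 : L * |u| = |B| * |u| + |C| * |u| := by simp only [L]; ring
        nlinarith
      have : (1 : ℝ) ≤ M ^ 2 := one_le_pow₀ hM
      nlinarith

theorem mono_bound (b ρ u : ℝ) (h : |u| ≤ ρ) : -(|b| * ρ) ≤ b * u := by
  have h1 : -(|b| * |u|) ≤ b * u := by rw [← abs_mul]; exact neg_abs_le _
  have := mul_le_mul_of_nonneg_left h (abs_nonneg b)
  linarith

set_option maxHeartbeats 1000000 in
theorem thin_posdef {f : ℤ → ℤ → ℝ} (F4 : ℝ → ℝ → ℝ) (b0 b1 b2 b3 c0 c1 c2 d0 d1 e k : ℝ) (hk : 0 < k)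
    (hF4 : ∀ x y, k * (x ^ 2 + y ^ 2) ^ 2 ≤ F4 x y)
    (hf : ∀ x y : ℤ, f x y = F4 x y + b0 * x ^ 3 + b1 * (x ^ 2 * y) + b2 * (x * y ^ 2) + b3 * y ^ 3
      + c0 * x ^ 2 + c1 * (x * y) + c2 * y ^ 2 + d0 * x + d1 * y + e) :
    Thin f (fun _ _ => True) := by
  set L := |b0| + |b1| + |b2| + |b3| + |c0| + |c1| + |c2| + |d0| + |d1| + |e| with hL
  have hL0 : 0 ≤ L := by positivity
  set R := 1 + 8 * L / k
  set K := 1 + 1 / (k / 8)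
  have hK0 : 0 ≤ K := by positivity
  have hR0 : 0 ≤ R := by positivity
  refine Thin.box (fun x _ => x) (fun _ y => y) f (R + K) (fun _ _ _ => rfl) ?_
  intro M hM x y _ hle
  rw [hf] at hle
  have h4 := hF4 x y
  generalize (x : ℝ) = x at *
  generalize (y : ℝ) = y at *
  set ρ := |x| + |y| with hρ
  have hx : |x| ≤ ρ := by simp [ρ]
  have hy : |y| ≤ ρ := by simp [ρ]
  have hρ0 : 0 ≤ ρ := by positivity
  have hmain : ρ ≤ (R + K) * M := by
    rcases le_total ρ R with h | h
    · nlinarith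
    · have hb : ρ ≤ K * M := by
        apply root4 (by positivity) hM hρ0
        have h1 : 1 ≤ ρ := le_trans (by simp [R]; positivity) h
        have h2 : 8 * L ≤ k * ρ := by
          have : 8 * L / k ≤ ρ := by simp only [R] at h; linarith
          rw [div_le_iff₀ hk] at this
          linarith
        have q1 : ρ ≤ ρ ^ 3 := le_self_pow₀ h1 (by norm_num)
        have q2 : ρ ^ 2 ≤ ρ ^ 3 := pow_le_pow_right₀ h1 (by norm_num)
        have q3 : 1 ≤ ρ ^ 3 := one_le_pow₀ h1
        have m1 := mono_bound b0 (ρ ^ 3) (x ^ 3) (by rw [abs_pow]; gcongr)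
        have m2 := mono_bound b1 (ρ ^ 3) (x ^ 2 * y) (by
          rw [abs_mul, abs_pow]
          calc |x| ^ 2 * |y| ≤ ρ ^ 2 * ρ := by gcongr
            _ = ρ ^ 3 := by ring)
        have m3 := mono_bound b2 (ρ ^ 3) (x * y ^ 2) (by
          rw [abs_mul, abs_pow]
          calc |x| * |y| ^ 2 ≤ ρ * ρ ^ 2 := by gcongr
            _ = ρ ^ 3 := by ring)
        have m4 := mono_bound b3 (ρ ^ 3) (y ^ 3) (by rw [abs_pow]; gcongr)
        have m5 := mono_bound c0 (ρ ^ 3) (x ^ 2) (by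
          rw [abs_pow]
          calc |x| ^ 2 ≤ ρ ^ 2 := by gcongr
            _ ≤ ρ ^ 3 := q2)
        have m6 := mono_bound c1 (ρ ^ 3) (x * y) (by
          rw [abs_mul]
          calc |x| * |y| ≤ ρ * ρ := by gcongr
            _ = ρ ^ 2 := by ring
            _ ≤ ρ ^ 3 := q2)
        have m7 := mono_bound c2 (ρ ^ 3) (y ^ 2) (by
          rw [abs_pow]
          calc |y| ^ 2 ≤ ρ ^ 2 := by gcongr
            _ ≤ ρ ^ 3 := q2)
        have m8 := mono_bound d0 (ρ ^ 3) x (hx.trans q1)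
        have m9 := mono_bound d1 (ρ ^ 3) y (hy.trans q1)
        have m10 := mono_bound e (ρ ^ 3) 1 (by simpa using q3)
        have hs : ρ ^ 2 ≤ 2 * (x ^ 2 + y ^ 2) := by
          have := sq_nonneg (|x| - |y|)
          have e1 := sq_abs x
          have e2 := sq_abs y
          have e3 : ρ ^ 2 = 2 * (|x| ^ 2 + |y| ^ 2) - (|x| - |y|) ^ 2 := by rw [hρ]; ring
          rw [e3, e1, e2]
          linarith only [this]
        have hs2 : ρ ^ 4 ≤ 4 * (x ^ 2 + y ^ 2) ^ 2 := by
          have := pow_le_pow_left₀ (by positivity) hs 2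
          have e3 : (ρ ^ 2) ^ 2 = ρ ^ 4 := by ring
          have e4 : (2 * (x ^ 2 + y ^ 2)) ^ 2 = 4 * (x ^ 2 + y ^ 2) ^ 2 := by ring
          rwa [e3, e4] at this
        have hs3 := mul_le_mul_of_nonneg_left hs2 hk.le
        have hs4 : 8 * L * ρ ^ 3 ≤ k * ρ * ρ ^ 3 := mul_le_mul_of_nonneg_right h2 (by positivity)
        have hs5 : L * ρ ^ 3 = |b0| * ρ ^ 3 + |b1| * ρ ^ 3 + |b2| * ρ ^ 3 + |b3| * ρ ^ 3 + |c0| * ρ ^ 3 +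
          |c1| * ρ ^ 3 + |c2| * ρ ^ 3 + |d0| * ρ ^ 3 + |d1| * ρ ^ 3 + |e| * ρ ^ 3 := by rw [hL]; ring
        have hs6 : k * ρ * ρ ^ 3 = k * ρ ^ 4 := by ring
        linarith
      nlinarith
  left
  exact ⟨le_sq_of_one_le (by positivity) hM (hx.trans hmain), hy.trans hmain⟩

theorem thin_strip {f : ℤ → ℤ → ℝ} (t : ℤ → ℤ → ℤ) (R : ℝ) (h : ∀ k : ℤ, Thin f (fun x y => t x y = k)) :
    Thin f (fun x y => |(t x y : ℝ)| ≤ R) := by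
  obtain ⟨N, hN⟩ := exists_nat_ge R
  refine (Thin.finset (Finset.Icc (-(N : ℤ)) N) (fun k x y => t x y = k) fun k _ => h k).mono ?_
  intro x y hxy
  refine ⟨t x y, ?_, rfl⟩
  have : |(t x y)| ≤ N := by exact_mod_cast hxy.trans hN
  exact Finset.mem_Icc.2 (abs_le.1 this)

set_option maxHeartbeats 1000000 in
theorem thin_B2a {f : ℤ → ℤ → ℝ} (a2 a3 a4 b1 b2 b3 c0 c1 c2 d0 d1 e k : ℝ) (hk : 0 < k)
    (hP : ∀ x y : ℝ, k * (x ^ 2 + y ^ 2) ≤ a2 * x ^ 2 + a3 * (x * y) + a4 * y ^ 2)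
    (hf : ∀ x y : ℤ, f x y = y ^ 2 * (a2 * x ^ 2 + a3 * (x * y) + a4 * y ^ 2)
      + y * (b1 * x ^ 2 + b2 * (x * y) + b3 * y ^ 2)
      + c0 * x ^ 2 + c1 * (x * y) + c2 * y ^ 2 + d0 * x + d1 * y + e)
    (h0 : ∀ x y, 0 ≤ f x y) :
    Thin f (fun _ _ => True) := by
  set L := |b1| + |b2| + |b3| + |c0| + |c1| + |c2| + |d0| + |d1| + |e| with hL
  have hL0 : 0 ≤ L := by positivity
  set R := 1 + 2 * L / k
  set K := 1 + 1 / (k / 2)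
  have hK0 : 0 ≤ K := by positivity
  have hR0 : 0 ≤ R := by positivity
  have fib : ∀ y0 : ℤ, Thin f (fun x y => y = y0) := by
    intro y0
    have key := poly4 (p4 := 0) (p3 := 0) (p2 := y0 ^ 2 * a2 + y0 * b1 + c0)
      (p1 := y0 ^ 3 * a3 + y0 ^ 2 * b2 + c1 * y0 + d0)
      (p0 := a4 * y0 ^ 4 + b3 * y0 ^ 3 + c2 * y0 ^ 2 + d1 * y0 + e) (B := 0) (fun t => by
        have := h0 t y0
        rw [hf] at this
        linarith)
    obtain ⟨_, k2⟩ := key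
    obtain ⟨_, k3, k4⟩ := k2 rfl
    refine Thin.quad (fun x _ => x) _ _ (a4 * y0 ^ 4 + b3 * y0 ^ 3 + c2 * y0 ^ 2 + d1 * y0 + e) ?_ k3 k4
    rintro x y rfl
    rw [hf]; ring
  have main : Thin f (fun x y => R ≤ |(y : ℝ)|) := by
    refine Thin.box (fun x _ => x) (fun _ y => y) f K (fun _ _ _ => rfl) ?_
    intro M hM x y hR hle
    rw [hf] at hle
    have h4 := hP x y
    generalize (x : ℝ) = x at *
    generalize (y : ℝ) = y at *
    have h1 : 1 ≤ |y| := le_trans (by simp [R]; positivity) hR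
    have h2 : 2 * L ≤ k * |y| := by
      have : 2 * L / k ≤ |y| := by simp only [R] at hR; linarith
      rw [div_le_iff₀ hk] at this
      linarith
    set s := x ^ 2 + y ^ 2 with hs
    have hy2 : 1 ≤ y ^ 2 := by rw [← sq_abs]; exact one_le_pow₀ h1
    have hs1 : 1 ≤ s := by rw [hs]; nlinarith [sq_nonneg x]
    have hxs : |x| ≤ s := by rw [hs]; nlinarith [sq_abs x, sq_nonneg (|x| - 1), sq_nonneg x]
    have hys : |y| ≤ s := by rw [hs]; nlinarith [sq_abs y, sq_nonneg (|y| - 1), sq_nonneg x]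
    have hx2s : |x ^ 2| ≤ s := by rw [abs_of_nonneg (sq_nonneg x)]; simp [s]; positivity
    have hy2s : |y ^ 2| ≤ s := by rw [abs_of_nonneg (sq_nonneg y)]; simp [s]; positivity
    have hxys : |x * y| ≤ s := by
      rw [abs_le]; constructor <;> nlinarith [sq_nonneg (x + y), sq_nonneg (x - y)]
    have hsy : s ≤ |y| * s := le_mul_of_one_le_left (by linarith) h1
    have big : ∀ u, |u| ≤ s → |y * u| ≤ |y| * s := fun u hu => by rw [abs_mul]; gcongr
    have m1 := mono_bound b1 (|y| * s) _ (big _ hx2s)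
    have m2 := mono_bound b2 (|y| * s) _ (big _ hxys)
    have m3 := mono_bound b3 (|y| * s) _ (big _ hy2s)
    have m4 := mono_bound c0 (|y| * s) _ (hx2s.trans hsy)
    have m5 := mono_bound c1 (|y| * s) _ (hxys.trans hsy)
    have m6 := mono_bound c2 (|y| * s) _ (hy2s.trans hsy)
    have m7 := mono_bound d0 (|y| * s) _ (hxs.trans hsy)
    have m8 := mono_bound d1 (|y| * s) _ (hys.trans hsy)
    have m9 := mono_bound e (|y| * s) 1 (by rw [abs_one]; linarith)
    have m10 := mul_le_mul_of_nonneg_left h4 (sq_nonneg y)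
    have m11 : 2 * L * (|y| * s) ≤ k * |y| * (|y| * s) :=
      mul_le_mul_of_nonneg_right h2 (by positivity)
    have m12 : k * |y| * (|y| * s) = k * y ^ 2 * s := by rw [← sq_abs y]; ring
    have m13 : L * (|y| * s) = |b1| * (|y| * s) + |b2| * (|y| * s) + |b3| * (|y| * s) + |c0| * (|y| * s)
      + |c1| * (|y| * s) + |c2| * (|y| * s) + |d0| * (|y| * s) + |d1| * (|y| * s) + |e| * (|y| * s) := by
      rw [hL]; ring
    have m14 : (k / 2) * (y ^ 2 * s) ≤ M ^ 4 := by linarith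
    left
    constructor
    · apply root2 (by positivity) hM (abs_nonneg x)
      rw [sq_abs]
      refine le_trans (mul_le_mul_of_nonneg_left ?_ (by positivity)) m14
      have e1 : y ^ 2 * s = x ^ 2 + (y ^ 2 - 1) * x ^ 2 + y ^ 4 := by rw [hs]; ring
      have e2 : 0 ≤ (y ^ 2 - 1) * x ^ 2 := mul_nonneg (by linarith only [hy2]) (sq_nonneg x)
      have e3 : 0 ≤ y ^ 4 := by positivity
      linarith only [e1, e2, e3]
    · apply root4 (by positivity) hM (abs_nonneg y)
      refine le_trans (mul_le_mul_of_nonneg_left ?_ (by positivity)) m14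
      have : |y| ^ 4 = y ^ 4 := by rw [show (4 : ℕ) = 2 * 2 by norm_num, pow_mul, pow_mul, sq_abs]
      rw [this]
      have e1 : y ^ 2 * s = x ^ 2 * y ^ 2 + y ^ 4 := by rw [hs]; ring
      have e2 : 0 ≤ x ^ 2 * y ^ 2 := by positivity
      linarith only [e1, e2]
  refine ((thin_strip (fun _ y => y) R fib).or main).mono fun x y _ => le_total _ _

set_option maxHeartbeats 1000000 in
theorem thin_B2b {f : ℤ → ℤ → ℝ} (m k : ℤ) (hm : m ≠ 0) (a l μ p q p' e d g : ℝ) (ha : 0 < a)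
    (hf : ∀ x y X : ℤ, X = m * x - k * y → f x y = a * ((y : ℝ) ^ 2 * X ^ 2) + l * (y * X ^ 2) + μ * (y ^ 2 * X)
      + p * X ^ 2 + q * (X * y) + p' * y ^ 2 + e * X + d * y + g)
    (h0 : ∀ x y, 0 ≤ f x y) :
    Thin f (fun _ _ => True) := by
  have hm' : (m : ℝ) ≠ 0 := by exact_mod_cast hm
  set L := |l| + |μ| + |p| + |q| + |p'| + |e| + |d| + |g| with hL
  have hL0 : 0 ≤ L := by positivity
  set R := 1 + 2 * L / a
  set K := 1 + 1 / (a / 2)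
  have hK0 : 0 ≤ K := by positivity
  have hR0 : 0 ≤ R := by positivity
  have fib1 : ∀ y0 : ℤ, Thin f (fun x y => y = y0) := by
    intro y0
    set A : ℝ := a * y0 ^ 2 + l * y0 + p with hA
    set B : ℝ := μ * y0 ^ 2 + q * y0 + e with hB
    have key := poly4 (p4 := 0) (p3 := 0) (p2 := A * m ^ 2)
      (p1 := - 2 * A * m * (k * y0) + B * m)
      (p0 := A * (k * y0) ^ 2 - B * (k * y0) + p' * y0 ^ 2 + d * y0 + g) (B := 0) (fun t => by
        have := h0 t y0
        rw [hf t y0 _ rfl] at this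
        push_cast at this
        rw [hA, hB]
        linarith)
    obtain ⟨_, k2⟩ := key
    obtain ⟨_, k3, k4⟩ := k2 rfl
    refine Thin.quad (fun x y => m * x - k * y) A B (p' * y0 ^ 2 + d * y0 + g) ?_ ?_ ?_
    · rintro x y rfl
      rw [hf x y _ rfl, hA, hB]; ring
    · exact nonneg_of_mul_nonneg_left k3 (by positivity)
    · intro hA0
      have := k4 (by rw [hA0]; ring)
      rw [hA0] at this
      simpa [hm'] using this
  have fib2 : ∀ X0 : ℤ, Thin f (fun x y => m * x - k * y = X0) := by
    intro X0
    by_cases hne : ∃ x1 y1 : ℤ, m * x1 - k * y1 = X0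
    · obtain ⟨x1, y1, h1⟩ := hne
      set A : ℝ := a * X0 ^ 2 + μ * X0 + p' with hA
      set B : ℝ := l * X0 ^ 2 + q * X0 + d with hB
      have key := poly4 (p4 := 0) (p3 := 0) (p2 := A * m ^ 2)
        (p1 := 2 * A * m * y1 + B * m)
        (p0 := A * y1 ^ 2 + B * y1 + p * X0 ^ 2 + e * X0 + g) (B := 0) (fun t => by
          have := h0 (x1 + k * t) (y1 + m * t)
          rw [hf _ _ X0 (by rw [← h1]; ring)] at this
          push_cast at this
          rw [hA, hB]
          linarith)
      obtain ⟨_, k2⟩ := key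
      obtain ⟨_, k3, k4⟩ := k2 rfl
      refine Thin.quad (fun x y => y) A B (p * X0 ^ 2 + e * X0 + g) ?_ ?_ ?_
      · rintro x y h
        rw [hf x y _ h.symm, hA, hB]; ring
      · exact nonneg_of_mul_nonneg_left k3 (by positivity)
      · intro hA0
        have := k4 (by rw [hA0]; ring)
        rw [hA0] at this
        simpa [hm'] using this
    · exact Thin.empty.mono fun x y h => hne ⟨x, y, h⟩
  have main : Thin f (fun x y => R ≤ |(y : ℝ)| ∧ R ≤ |((m * x - k * y : ℤ) : ℝ)|) := by
    refine Thin.box (fun x y => m * x - k * y) (fun _ y => y) (fun X y => a * ((y : ℝ) ^ 2 * X ^ 2) + l * (y * X ^ 2) + μ * (y ^ 2 * X)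
      + p * X ^ 2 + q * (X * y) + p' * y ^ 2 + e * X + d * y + g) K (fun x y _ => hf x y _ rfl) ?_
    rintro M hM x y ⟨hRy, hRX⟩ hle
    rw [hf x y _ rfl] at hle
    generalize ((m * x - k * y : ℤ) : ℝ) = X at *
    generalize (y : ℝ) = y at *
    have hR1 : 1 ≤ R := by simp [R]; positivity
    have hX1 : 1 ≤ |X| := hR1.trans hRX
    have hy1 : 1 ≤ |y| := hR1.trans hRy
    have h2 : 2 * L ≤ a * R := by
      simp only [R]; field_simp; linarith
    set W := |y| ^ 2 * |X| ^ 2 with hW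
    have hW0 : 0 ≤ W := by positivity
    have hWe : y ^ 2 * X ^ 2 = W := by rw [hW, sq_abs, sq_abs]
    -- each lower monomial times R is at most W
    have hyy : |y| ≤ |y| ^ 2 := le_self_pow₀ hy1 (by norm_num)
    have hXX : |X| ≤ |X| ^ 2 := le_self_pow₀ hX1 (by norm_num)
    have hy2 : 1 ≤ |y| ^ 2 := one_le_pow₀ hy1
    have hX2 : 1 ≤ |X| ^ 2 := one_le_pow₀ hX1
    have hyR : R * |y| ≤ |y| ^ 2 := by rw [sq]; gcongr
    have hXR : R * |X| ≤ |X| ^ 2 := by rw [sq]; gcongr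
    have hRy2 : R ≤ |y| ^ 2 := hRy.trans hyy
    set V := W / R with hV
    have hRp : 0 < R := by linarith
    have big : ∀ u v : ℝ, 0 ≤ v → R * u ≤ |y| ^ 2 → v ≤ |X| ^ 2 → u * v ≤ V := by
      intro u v hv h1 h2
      rw [hV, le_div_iff₀ hRp, hW]
      calc u * v * R = (R * u) * v := by ring
        _ ≤ |y| ^ 2 * |X| ^ 2 := mul_le_mul h1 h2 hv (by positivity)
    have big' : ∀ u v : ℝ, 0 ≤ v → R * u ≤ |X| ^ 2 → v ≤ |y| ^ 2 → u * v ≤ V := by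
      intro u v hv h1 h2
      rw [hV, le_div_iff₀ hRp, hW]
      calc u * v * R = v * (R * u) := by ring
        _ ≤ |y| ^ 2 * (|X| ^ 2) := by
          refine (mul_le_mul_of_nonneg_left h1 hv).trans (mul_le_mul_of_nonneg_right h2 (by positivity))
    have m1 := mono_bound l V (y * X ^ 2) (by
      rw [abs_mul, abs_pow]; exact big _ _ (by positivity) hyR le_rfl)
    have m2 := mono_bound μ V (y ^ 2 * X) (by
      rw [abs_mul, abs_pow, mul_comm]; exact big' _ _ (by positivity) hXR le_rfl)
    have m3 := mono_bound p V (X ^ 2) (by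
      rw [abs_pow, ← one_mul (|X| ^ 2)]; exact big _ _ (by positivity) (by rw [mul_one]; exact hRy2) le_rfl)
    have m4 := mono_bound q V (X * y) (by
      rw [abs_mul, mul_comm]; exact big _ _ (by positivity) hyR hXX)
    have m5 := mono_bound p' V (y ^ 2) (by
      rw [abs_pow, ← one_mul (|y| ^ 2)]; exact big' _ _ (by positivity) (by rw [mul_one]; exact hRX.trans hXX) le_rfl)
    have m6 := mono_bound e V X (by
      rw [← one_mul |X|]; exact big _ _ (by positivity) (by rw [mul_one]; exact hRy2) hXX)
    have m7 := mono_bound d V y (by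
      rw [← mul_one |y|]; exact big _ _ (by positivity) hyR hX2)
    have m8 := mono_bound g V 1 (by
      rw [abs_one, ← one_mul (1 : ℝ)]; exact big _ _ (by positivity) (by rw [mul_one]; exact hRy2) hX2)
    have hVW : W = R * V := by rw [hV]; field_simp
    have hV0 : 0 ≤ V := by positivity
    have m9 : 2 * L * V ≤ a * R * V := mul_le_mul_of_nonneg_right h2 hV0
    have m10 : L * V = |l| * V + |μ| * V + |p| * V + |q| * V + |p'| * V + |e| * V + |d| * V + |g| * V := by
      rw [hL]; ring
    have m11 : a * W = a * R * V := by rw [hVW]; ring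
    rw [hWe] at hle
    have m12 : (a / 2) * W ≤ M ^ 4 := by linarith
    have m13 : |y| * |X| ≤ K * M ^ 2 := by
      apply root2 (by positivity) hM (by positivity)
      rw [mul_pow]; exact m12
    have hX0 : 0 ≤ |X| := abs_nonneg X
    have hy0 : 0 ≤ |y| := abs_nonneg y
    have hK1 : 1 ≤ K := by simp [K]; positivity
    rcases le_total |X| M with h | h
    · right
      constructor
      · exact h.trans (le_mul_of_one_le_left (by linarith only [hM]) hK1)
      · exact (le_mul_of_one_le_right hy0 hX1).trans m13
    · left
      constructor
      · exact (le_mul_of_one_le_left hX0 hy1).trans m13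
      · have : |y| * M ≤ K * M * M := by
          have := mul_le_mul_of_nonneg_left h hy0
          have e1 : K * M * M = K * M ^ 2 := by ring
          linarith only [this, m13, e1]
        exact le_of_mul_le_mul_right this (by linarith only [hM])
  refine (((thin_strip (fun _ y => y) R fib1).or (thin_strip (fun x y => m * x - k * y) R fib2)).or main).mono fun x y _ => ?_
  rcases le_total |(y : ℝ)| R with h | h
  · exact Or.inl (Or.inl h)
  · rcases le_total |((m * x - k * y : ℤ) : ℝ)| R with h' | h'
    · exact Or.inl (Or.inr h')
    · exact Or.inr ⟨h, h'⟩

open scoped NumberTheorySymbols in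
theorem exists_inert (K : ℤ) (D : ℕ) (hK : K ≠ 0) (hD : 0 < D) :
    ∃ p : ℕ, p.Prime ∧ ¬ (p : ℤ) ∣ K ∧ ¬ (p : ℤ) ∣ D ∧ J(-(D : ℤ) | p) = -1 := by
  set k := K.natAbs with hk
  have hk0 : 0 < k := Int.natAbs_pos.2 hK
  have hpos : 0 < D * k ^ 2 := by positivity
  obtain ⟨N, hN⟩ : ∃ N : ℕ, N + 1 = 4 * (D * k ^ 2) := ⟨4 * (D * k ^ 2) - 1, by omega⟩
  have hodd : N % 2 = 1 := by omega
  have h34 : N % 4 = 3 := by omega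
  have hNz : (4 * (D * k ^ 2) : ℤ) = N + 1 := by exact_mod_cast hN.symm
  have hcop : ∀ p : ℕ, p.Prime → p ∣ N → p ∣ 4 * (D * k ^ 2) → False := by
    intro p hp h1 h2
    rw [← hN] at h2
    exact hp.one_lt.ne' (Nat.dvd_one.1 ((Nat.dvd_add_right h1).1 h2))
  have h1 : J((4 * (D * k ^ 2) : ℤ) | N) = 1 := by
    rw [hNz, jacobiSym.mod_left]
    have : ((N : ℤ) + 1) % N = 1 % N := by simp
    rw [this, ← jacobiSym.mod_left, jacobiSym.one_left]
  have hg : Int.gcd ((2 * k : ℕ) : ℤ) N = 1 := by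
    rw [Int.gcd_natCast_natCast]
    by_contra hne
    obtain ⟨p, hp, hpd⟩ := Nat.exists_prime_and_dvd hne
    refine hcop p hp (hpd.trans (Nat.gcd_dvd_right _ _)) ((hpd.trans (Nat.gcd_dvd_left _ _)).trans ⟨2 * D * k, by ring⟩)
  have h2 : J((D : ℤ) | N) = 1 := by
    have e : (4 * (D * k ^ 2) : ℤ) = ((2 * k : ℕ) : ℤ) ^ 2 * D := by push_cast; ring
    rw [e, jacobiSym.mul_left, jacobiSym.sq_one' hg, one_mul] at h1
    exact h1
  have h3 : J(-(D : ℤ) | N) = -1 := by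
    rw [← neg_one_mul, jacobiSym.mul_left, h2, mul_one, jacobiSym.at_neg_one (Nat.odd_iff.2 hodd),
      ZMod.χ₄_nat_three_mod_four h34]
  obtain ⟨p, hp, hpN, hJ⟩ := jacobiSym.eq_neg_one_at_prime_divisor_of_eq_neg_one h3
  refine ⟨p, hp, ?_, ?_, hJ⟩
  · intro h
    have : p ∣ k := Int.natCast_dvd.1 h
    exact hcop p hp hpN (this.trans ⟨4 * D * k, by ring⟩)
  · intro h
    have : p ∣ D := by exact_mod_cast h
    exact hcop p hp hpN (this.trans ⟨4 * k ^ 2, by ring⟩)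

theorem local_obs (K k0 A B : ℤ) (hK : K ≠ 0) (hA : 0 < A) (hB : 0 < B) :
    ∃ n : ℕ, ∀ U W : ℤ, K * n + k0 ≠ A * U ^ 2 + B * W ^ 2 := by
  obtain ⟨D, hD⟩ : ∃ D : ℕ, (D : ℤ) = A * B := ⟨(A * B).toNat, Int.toNat_of_nonneg (by positivity)⟩
  have hD0 : 0 < D := by
    have : 0 < A * B := by positivity
    rw [← hD] at this; exact_mod_cast this
  obtain ⟨p, hp, hpK, hpD, hJ⟩ := exists_inert K D hK hD0
  have hpp : Prime (p : ℤ) := Nat.prime_iff_prime_int.1 hp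
  have : Fact p.Prime := ⟨hp⟩
  have hcop : IsCoprime K ((p : ℤ) ^ 2) := by
    apply IsCoprime.pow_right
    exact ((Prime.coprime_iff_not_dvd hpp).2 hpK).symm
  obtain ⟨u, v, huv⟩ := hcop
  -- n ≡ u (p - k0) mod p^2, n ≥ 0
  set n0 := (u * (p - k0)) % ((p : ℤ) ^ 2) with hn0
  have hp2 : (0 : ℤ) < (p : ℤ) ^ 2 := by
    have := hp.pos
    positivity
  have hn0' : 0 ≤ n0 := Int.emod_nonneg _ hp2.ne'
  refine ⟨n0.toNat, ?_⟩
  rw [Int.toNat_of_nonneg hn0']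
  intro U W heq
  have hmod : ∃ c, K * n0 + k0 = p + (p : ℤ) ^ 2 * c := by
    refine ⟨- v * (p - k0) - K * ((u * (p - k0)) / ((p : ℤ) ^ 2)), ?_⟩
    have := Int.mul_ediv_add_emod (u * (p - k0)) ((p : ℤ) ^ 2)
    rw [← hn0] at this
    linear_combination K * this + (p - k0) * huv
  obtain ⟨c, hc⟩ := hmod
  rw [heq] at hc
  have hdvd : (p : ℤ) ∣ (A * U) ^ 2 - (-(D : ℤ)) * W ^ 2 :=
    ⟨A * (1 + p * c), by rw [hD]; linear_combination A * hc⟩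
  obtain ⟨h1, ⟨w, hw⟩⟩ := jacobiSym.prime_dvd_of_eq_neg_one hJ hdvd
  have hU : (p : ℤ) ∣ U := by
    rcases hpp.dvd_or_dvd h1 with h | h
    · exact absurd (h.trans ⟨B, hD⟩) hpD
    · exact h
  obtain ⟨z, hz⟩ := hU
  subst hz; subst hw
  have hp0 : (p : ℤ) ≠ 0 := by exact_mod_cast hp.ne_zero
  have : (p : ℤ) * (A * z ^ 2 + B * w ^ 2 - c) = 1 := by
    apply mul_left_cancel₀ hp0
    linear_combination hc
  exact hpp.not_isUnit (IsUnit.of_mul_eq_one _ this)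

theorem clear_list (l : List ℚ) : ∃ m : ℤ, 0 < m ∧ ∀ q ∈ l, ∃ z : ℤ, m * q = z := by
  induction l with
  | nil => exact ⟨1, by norm_num, by simp⟩
  | cons a l ih =>
    obtain ⟨m, hm, h⟩ := ih
    refine ⟨m * a.den, by have := a.den_pos; positivity, ?_⟩
    intro q hq
    rcases List.mem_cons.1 hq with rfl | hq
    · refine ⟨m * q.num, ?_⟩
      push_cast
      rw [mul_assoc, Rat.den_mul_eq_num]
    · obtain ⟨z, hz⟩ := h q hq
      refine ⟨z * a.den, ?_⟩
      push_cast
      rw [← hz]; ring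

theorem quartic_growth {p4 p3 p2 p1 p0 : ℝ} (hp : 0 < p4) : ∃ C : ℝ, 0 ≤ C ∧ ∀ M : ℝ, 1 ≤ M → ∀ t : ℝ,
    p4 * t ^ 4 + p3 * t ^ 3 + p2 * t ^ 2 + p1 * t + p0 ≤ M ^ 4 → |t| ≤ C * M := by
  set L := |p3| + |p2| + |p1| + |p0| with hL
  have hL0 : 0 ≤ L := by positivity
  set R := 1 + 2 * L / p4
  set K := 1 + 1 / (p4 / 2)
  have hK0 : 0 ≤ K := by positivity
  have hR0 : 0 ≤ R := by positivity
  refine ⟨R + K, by positivity, ?_⟩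
  intro M hM t hle
  rcases le_total |t| R with h | h
  · nlinarith
  · have hb : |t| ≤ K * M := by
      apply root4 (by positivity) hM (abs_nonneg t)
      have h1 : 1 ≤ |t| := le_trans (by simp [R]; positivity) h
      have h2 : 2 * L ≤ p4 * |t| := by
        have : 2 * L / p4 ≤ |t| := by simp only [R] at h; linarith
        rw [div_le_iff₀ hp] at this
        linarith
      have m1 := mono_bound p3 (|t| ^ 3) (t ^ 3) (by rw [abs_pow])
      have m2 := mono_bound p2 (|t| ^ 3) (t ^ 2) (by rw [abs_pow]; exact pow_le_pow_right₀ h1 (by norm_num))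
      have m3 := mono_bound p1 (|t| ^ 3) t (le_self_pow₀ h1 (by norm_num))
      have m4 := mono_bound p0 (|t| ^ 3) 1 (by rw [abs_one]; exact one_le_pow₀ h1)
      have m5 : 2 * L * |t| ^ 3 ≤ p4 * |t| * |t| ^ 3 := mul_le_mul_of_nonneg_right h2 (by positivity)
      have m6 : L * |t| ^ 3 = |p3| * |t| ^ 3 + |p2| * |t| ^ 3 + |p1| * |t| ^ 3 + |p0| * |t| ^ 3 := by rw [hL]; ring
      have m7 : p4 * |t| * |t| ^ 3 = p4 * |t| ^ 4 := by ring
      have m8 : |t| ^ 4 = t ^ 4 := by rw [show (4 : ℕ) = 2 * 2 by norm_num, pow_mul, pow_mul, sq_abs]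
      rw [m8] at m7 ⊢
      linarith
    nlinarith

theorem case_B2c {f : ℤ → ℤ → ℝ} (a4 b2 b3 c0 c1 c2 d0 d1 e : ℚ)
    (hf : ∀ x y : ℤ, f x y = ((a4 * y ^ 4 + b2 * (x * y ^ 2) + b3 * y ^ 3 + c0 * x ^ 2 + c1 * (x * y) + c2 * y ^ 2
      + d0 * x + d1 * y + e : ℚ) : ℝ))
    (h0 : ∀ x y, 0 ≤ f x y) (hs : ∀ n : ℕ, ∃ x y, f x y = n) : False := by
  have row : ∀ y : ℤ, 0 ≤ (c0 : ℝ) ∧ ((c0 : ℝ) = 0 → (b2 : ℝ) * y ^ 2 + c1 * y + d0 = 0) := by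
    intro y
    obtain ⟨_, k2⟩ := poly4 (p4 := 0) (p3 := 0) (p2 := c0)
      (p1 := b2 * y ^ 2 + c1 * y + d0)
      (p0 := a4 * y ^ 4 + b3 * y ^ 3 + c2 * y ^ 2 + d1 * y + e) (B := 0) (fun t => by
        have := h0 t y
        rw [hf] at this
        push_cast at this
        linarith)
    exact (k2 rfl).2
  rcases (row 0).1.eq_or_lt with hc | hc
  · -- no dependence on x
    have hfy : ∀ x y, f x y = a4 * y ^ 4 + b3 * y ^ 3 + c2 * y ^ 2 + d1 * y + e := by
      intro x y
      rw [hf]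
      push_cast
      have := (row y).2 hc.symm
      rw [← hc]
      linear_combination x * this
    obtain ⟨k1, k2⟩ := poly4 (p4 := a4) (p3 := b3) (p2 := c2) (p1 := d1) (p0 := e) (B := 0)
      (fun t => by have := h0 0 t; rwa [hfy] at this)
    refine Thin.contra ?_ hs
    rcases k1.eq_or_lt with k1 | k1
    · obtain ⟨k3, k4, k5⟩ := k2 k1.symm
      exact Thin.quad (fun _ y => y) c2 d1 e (fun x y _ => by rw [hfy, ← k1, k3]; ring) k4 k5
    · obtain ⟨C, hC0, hC⟩ := quartic_growth (p3 := b3) (p2 := c2) (p1 := d1) (p0 := e) k1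
      refine Thin.box (fun _ _ => 0) (fun _ y => y) (fun _ y => a4 * y ^ 4 + b3 * y ^ 3 + c2 * y ^ 2 + d1 * y + e) C
        (fun x y _ => hfy x y) ?_
      intro M hM x y _ hle
      rw [hfy] at hle
      left
      refine ⟨by simp; positivity, hC M hM y hle⟩
  · have hc' : 0 < c0 := by exact_mod_cast hc
    obtain ⟨g2, hg2⟩ : ∃ g : ℚ, g = b2 / (2 * c0) := ⟨_, rfl⟩
    obtain ⟨g1, hg1⟩ : ∃ g : ℚ, g = c1 / (2 * c0) := ⟨_, rfl⟩
    obtain ⟨g0, hg0⟩ : ∃ g : ℚ, g = d0 / (2 * c0) := ⟨_, rfl⟩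
    obtain ⟨p4, hp4⟩ : ∃ g : ℚ, g = a4 - c0 * g2 ^ 2 := ⟨_, rfl⟩
    obtain ⟨p3, hp3⟩ : ∃ g : ℚ, g = b3 - 2 * c0 * g2 * g1 := ⟨_, rfl⟩
    obtain ⟨p2, hp2⟩ : ∃ g : ℚ, g = c2 - c0 * (g1 ^ 2 + 2 * g2 * g0) := ⟨_, rfl⟩
    obtain ⟨p1, hp1⟩ : ∃ g : ℚ, g = d1 - 2 * c0 * g1 * g0 := ⟨_, rfl⟩
    obtain ⟨p0, hp0⟩ : ∃ g : ℚ, g = e - c0 * g0 ^ 2 := ⟨_, rfl⟩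
    have hfq : ∀ x y : ℤ, f x y = ((c0 * (x + (g2 * y ^ 2 + g1 * y + g0)) ^ 2 +
        (p4 * y ^ 4 + p3 * y ^ 3 + p2 * y ^ 2 + p1 * y + p0) : ℚ) : ℝ) := by
      intro x y
      rw [hf]
      congr 1
      have e2 : 2 * c0 * g2 = b2 := by rw [hg2]; field_simp
      have e1 : 2 * c0 * g1 = c1 := by rw [hg1]; field_simp
      have e0 : 2 * c0 * g0 = d0 := by rw [hg0]; field_simp
      rw [hp4, hp3, hp2, hp1, hp0, ← e2, ← e1, ← e0]; ring
    have hfr : ∀ x y : ℤ, f x y = c0 * ((x : ℝ) + (g2 * y ^ 2 + g1 * y + g0)) ^ 2 +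
        (p4 * y ^ 4 + p3 * y ^ 3 + p2 * y ^ 2 + p1 * y + p0) := by
      intro x y; rw [hfq]; push_cast; ring
    have hh : ∀ y : ℤ, -(c0 : ℝ) ≤ p4 * y ^ 4 + p3 * y ^ 3 + p2 * y ^ 2 + p1 * y + p0 := by
      intro y
      have := h0 (-⌊(g2 * y ^ 2 + g1 * y + g0 : ℝ)⌋) y
      rw [hfr] at this
      have h1 := Int.fract_nonneg (g2 * y ^ 2 + g1 * y + g0 : ℝ)
      have h2 := (Int.fract_lt_one (g2 * y ^ 2 + g1 * y + g0 : ℝ)).le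
      have h3 : (((-⌊(g2 * y ^ 2 + g1 * y + g0 : ℝ)⌋ : ℤ) : ℝ) + (g2 * y ^ 2 + g1 * y + g0))
        = Int.fract (g2 * y ^ 2 + g1 * y + g0 : ℝ) := by
        rw [Int.fract]; push_cast; ring
      rw [h3] at this
      have h4 : (Int.fract (g2 * y ^ 2 + g1 * y + g0 : ℝ)) ^ 2 ≤ 1 := pow_le_one₀ h1 h2
      have := mul_le_mul_of_nonneg_left h4 hc.le
      linarith
    obtain ⟨k1, k2⟩ := poly4 hh
    rcases k1.eq_or_lt with k1 | k1
    · obtain ⟨k3, k4, k5⟩ := k2 k1.symm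
      have z4 : p4 = 0 := by exact_mod_cast k1.symm
      have z3 : p3 = 0 := by exact_mod_cast k3
      rcases k4.eq_or_lt with k4 | k4
      · have z2 : p2 = 0 := by exact_mod_cast k4.symm
        have z1 : p1 = 0 := by exact_mod_cast k5 k4.symm
        obtain ⟨m, hm, hmz⟩ := clear_list [g2, g1, g0]
        obtain ⟨G2, hG2⟩ := hmz g2 (by simp)
        obtain ⟨G1, hG1⟩ := hmz g1 (by simp)
        obtain ⟨G0, hG0⟩ := hmz g0 (by simp)
        have hmr : (0 : ℝ) < m := by exact_mod_cast hm
        refine Thin.contra (Thin.quad (fun x y => m * x + G2 * y ^ 2 + G1 * y + G0) (c0 / m ^ 2) 0 p0 ?_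
          (by positivity) (fun _ => rfl)) hs
        intro x y _
        have e2 : (m : ℝ) * g2 = G2 := by exact_mod_cast hG2
        have e1 : (m : ℝ) * g1 = G1 := by exact_mod_cast hG1
        have e0 : (m : ℝ) * g0 = G0 := by exact_mod_cast hG0
        rw [hfr, z4, z3, z2, z1]
        push_cast
        rw [← e2, ← e1, ← e0]
        field_simp
        ring
      · have z2 : 0 < p2 := by exact_mod_cast k4
        obtain ⟨s, hs'⟩ : ∃ s : ℚ, s = p1 / (2 * p2) := ⟨_, rfl⟩
        obtain ⟨r, hr⟩ : ∃ r : ℚ, r = p0 - p2 * s ^ 2 := ⟨_, rfl⟩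
        obtain ⟨m, hm, hmz⟩ := clear_list [g2, g1, g0, s]
        obtain ⟨G2, hG2⟩ := hmz g2 (by simp)
        obtain ⟨G1, hG1⟩ := hmz g1 (by simp)
        obtain ⟨G0, hG0⟩ := hmz g0 (by simp)
        obtain ⟨Z, hZ⟩ := hmz s (by simp)
        obtain ⟨n, hn, hnz⟩ := clear_list [c0, p2, r]
        obtain ⟨A, hA⟩ := hnz c0 (by simp)
        obtain ⟨B, hB⟩ := hnz p2 (by simp)
        obtain ⟨r', hr'⟩ := hnz r (by simp)
        have hnq : (0 : ℚ) < n := by exact_mod_cast hn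
        have hA0 : 0 < A := by
          have : (0 : ℚ) < A := by rw [← hA]; positivity
          exact_mod_cast this
        have hB0 : 0 < B := by
          have : (0 : ℚ) < B := by rw [← hB]; positivity
          exact_mod_cast this
        obtain ⟨N, hN⟩ := local_obs (n * m ^ 2) (-(m ^ 2 * r')) A B (by positivity) hA0 hB0
        obtain ⟨x, y, hxy⟩ := hs N
        refine hN (m * x + G2 * y ^ 2 + G1 * y + G0) (m * y + Z) ?_
        rw [hfq] at hxy
        have hq : (c0 * (x + (g2 * y ^ 2 + g1 * y + g0)) ^ 2 +
          (p4 * y ^ 4 + p3 * y ^ 3 + p2 * y ^ 2 + p1 * y + p0) : ℚ) = N := by exact_mod_cast hxy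
        have es : 2 * p2 * s = p1 := by rw [hs']; field_simp
        have hq' : ((n * m ^ 2 : ℤ) * (N : ℤ) + (-(m ^ 2 * r') : ℤ) : ℚ) =
          ((A * (m * x + G2 * y ^ 2 + G1 * y + G0) ^ 2 + B * (m * y + Z) ^ 2 : ℤ) : ℚ) := by
          push_cast
          rw [← hG2, ← hG1, ← hG0, ← hZ, ← hA, ← hB, ← hr', ← hq, z4, z3, hr, ← es]
          ring
        exact_mod_cast hq'
    · obtain ⟨C, hC0, hC⟩ := quartic_growth (p3 := p3) (p2 := p2) (p1 := p1) (p0 := p0) k1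
      have hk : (0 : ℝ) < c0 / (1 + c0) := by positivity
      set K : ℝ := 1 + 1 / (c0 / (1 + c0)) with hK
      refine Thin.contra (Thin.box (fun x y => x + ⌊(g2 * y ^ 2 + g1 * y + g0 : ℝ)⌋) (fun _ y => y)
        (fun i y => f (i - ⌊(g2 * y ^ 2 + g1 * y + g0 : ℝ)⌋) y) (C + K + 1) (fun x y _ => by simp) ?_) hs
      intro M hM x y _ hle
      rw [hfr] at hle
      have hy := hh y
      have hsq := mul_nonneg hc.le (sq_nonneg ((x : ℝ) + (g2 * y ^ 2 + g1 * y + g0)))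
      left
      have hK0 : 0 ≤ K := by positivity
      constructor
      · have h1 := Int.fract_nonneg (g2 * y ^ 2 + g1 * y + g0 : ℝ)
        have h2 := (Int.fract_lt_one (g2 * y ^ 2 + g1 * y + g0 : ℝ)).le
        have h3 : ((x + ⌊(g2 * y ^ 2 + g1 * y + g0 : ℝ)⌋ : ℤ) : ℝ) =
          ((x : ℝ) + (g2 * y ^ 2 + g1 * y + g0)) - Int.fract (g2 * y ^ 2 + g1 * y + g0 : ℝ) := by
          rw [Int.fract]; push_cast; ring
        rw [h3]
        generalize Int.fract (g2 * y ^ 2 + g1 * y + g0 : ℝ) = φ at *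
        generalize ((x : ℝ) + (g2 * y ^ 2 + g1 * y + g0)) = u at *
        have hM4 : 1 ≤ M ^ 4 := one_le_pow₀ hM
        have hM2 : 1 ≤ M ^ 2 := one_le_pow₀ hM
        have hu : |u| ≤ K * M ^ 2 := by
          apply root2 hk hM (abs_nonneg u)
          rw [sq_abs, div_mul_eq_mul_div, div_le_iff₀ (by positivity)]
          nlinarith
        have : |u - φ| ≤ |u| + |φ| := abs_sub _ _
        rw [abs_of_nonneg h1] at this
        nlinarith
      · have := hC M hM y (by linarith)
        nlinarith

theorem pell_orbit (d : ℤ) (hd0 : 0 < d) (hd : ¬ IsSquare d) (b h σ τ : ℚ) (hh : h ≠ 0) (x0 y0 : ℤ)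
    (R : ℝ) : ∃ η : ℝ, η > R ∧ 0 < η ∧ ∃ x y : ℤ,
      ((x : ℝ) + b * y + σ) + √d * (h * y + τ) = η * ((x0 + b * y0 + σ) + √d * (h * y0 + τ)) ∧
      ((x : ℝ) + b * y + σ) - √d * (h * y + τ) = η⁻¹ * ((x0 + b * y0 + σ) - √d * (h * y0 + τ)) := by
  obtain ⟨X0, hX0⟩ : ∃ X0 : ℚ, X0 = x0 + b * y0 + σ := ⟨_, rfl⟩
  obtain ⟨Y0, hY0⟩ : ∃ Y0 : ℚ, Y0 = h * y0 + τ := ⟨_, rfl⟩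
  obtain ⟨k, hk, hkz⟩ := clear_list [X0, Y0, X0 / h, Y0 / h, b * X0 / h, b * Y0 / h]
  obtain ⟨z1, hz1⟩ := hkz X0 (by simp)
  obtain ⟨z2, hz2⟩ := hkz Y0 (by simp)
  obtain ⟨z3, hz3⟩ := hkz (X0 / h) (by simp)
  obtain ⟨z4, hz4⟩ := hkz (Y0 / h) (by simp)
  obtain ⟨z5, hz5⟩ := hkz (b * X0 / h) (by simp)
  obtain ⟨z6, hz6⟩ := hkz (b * Y0 / h) (by simp)
  obtain ⟨N, hN⟩ := exists_nat_gt (max R 1)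
  have hN1 : (1 : ℝ) < N := lt_of_le_of_lt (le_max_right _ _) hN
  have hNR : R < N := lt_of_le_of_lt (le_max_left _ _) hN
  have hN0 : (0 : ℤ) < N := by
    have : (0 : ℝ) < N := by linarith
    exact_mod_cast this
  set K : ℤ := k * N with hK
  have hK0 : 0 < K := by positivity
  have hns : ¬ IsSquare (d * K ^ 2) := by
    rintro ⟨r, hr⟩
    apply hd
    have : K ^ 2 ∣ r ^ 2 := ⟨d, by rw [sq r, ← hr]; ring⟩
    obtain ⟨c, rfl⟩ := (Int.pow_dvd_pow_iff (by norm_num)).1 this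
    refine ⟨c, ?_⟩
    have h2 : K ^ 2 ≠ 0 := by positivity
    apply mul_left_cancel₀ h2
    linear_combination hr
  obtain ⟨a', b', hab, hb'⟩ := Pell.exists_of_not_isSquare (d := d * K ^ 2) (by positivity) hns
  obtain ⟨a, ha⟩ : ∃ a, a = |a'| := ⟨_, rfl⟩
  obtain ⟨β, hβ⟩ : ∃ β, β = |b'| := ⟨_, rfl⟩
  have hβ0 : 0 < β := by rw [hβ]; exact abs_pos.2 hb'
  have hab2 : a ^ 2 - d * K ^ 2 * β ^ 2 = 1 := by rw [ha, hβ, sq_abs, sq_abs]; exact hab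
  have ha0 : 0 < a := by
    rw [ha]; apply abs_pos.2; rintro rfl
    have : 0 ≤ d * K ^ 2 * b' ^ 2 := by positivity
    linarith
  -- A = 1 + K i, B = K j
  obtain ⟨i, hi⟩ : ∃ i, i = 2 * d * K * β ^ 2 := ⟨_, rfl⟩
  obtain ⟨j, hj⟩ : ∃ j, j = 2 * a * β := ⟨_, rfl⟩
  have hi0 : 0 < i := by rw [hi]; positivity
  have hj0 : 0 < j := by rw [hj]; positivity
  have hnorm : (1 + K * i) ^ 2 - d * (K * j) ^ 2 = 1 := by
    rw [hi, hj]; linear_combination (- 4 * d * K ^ 2 * β ^ 2) * hab2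
  set s := √(d : ℝ) with hs
  have hdR : (1 : ℝ) ≤ d := by exact_mod_cast hd0
  have hss : s * s = d := Real.mul_self_sqrt (by linarith)
  have hs1 : 1 ≤ s := by rw [hs]; exact Real.one_le_sqrt.2 hdR
  obtain ⟨A, hA⟩ : ∃ A : ℝ, A = 1 + K * i := ⟨_, rfl⟩
  obtain ⟨B, hB⟩ : ∃ B : ℝ, B = K * j := ⟨_, rfl⟩
  have hABn : (A + B * s) * (A - B * s) = 1 := by
    have : (A : ℝ) ^ 2 - d * B ^ 2 = 1 := by rw [hA, hB]; exact_mod_cast hnorm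
    linear_combination this - B ^ 2 * hss
  have hBN : (N : ℝ) ≤ B := by
    rw [hB]
    have : (N : ℤ) ≤ K * j := by
      rw [hK]; nlinarith [mul_pos hN0 hj0, mul_pos hk hj0]
    exact_mod_cast this
  have hA1 : 1 ≤ A := by
    rw [hA]
    have : (0 : ℝ) ≤ K * i := by
      have : 0 ≤ K * i := by positivity
      exact_mod_cast this
    linarith
  have hη : N ≤ A + B * s := by nlinarith
  have hηi : (A + B * s)⁻¹ = A - B * s := inv_eq_of_mul_eq_one_right hABn
  refine ⟨A + B * s, by linarith, by linarith, x0 + N * (i * z1 + d * j * z2 - (j * z5 + i * z6)),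
    y0 + N * (j * z3 + i * z4), ?_⟩
  rw [hηi]
  have hhR : (h : ℝ) ≠ 0 := by exact_mod_cast hh
  have ey : (h : ℝ) * ((y0 + N * (j * z3 + i * z4) : ℤ) : ℝ) + τ = B * X0 + A * Y0 := by
    have : h * ((y0 + N * (j * z3 + i * z4) : ℤ) : ℚ) + τ = (K * j : ℤ) * X0 + (1 + K * i : ℤ) * Y0 := by
      push_cast
      rw [← hz3, ← hz4, hK]
      push_cast
      field_simp
      rw [hY0]; ring
    rw [hA, hB]
    exact_mod_cast this
  have ex : ((x0 + N * (i * z1 + d * j * z2 - (j * z5 + i * z6)) : ℤ) : ℝ) +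
      b * ((y0 + N * (j * z3 + i * z4) : ℤ) : ℝ) + σ = A * X0 + d * B * Y0 := by
    have : ((x0 + N * (i * z1 + d * j * z2 - (j * z5 + i * z6)) : ℤ) : ℚ) +
      b * ((y0 + N * (j * z3 + i * z4) : ℤ) : ℚ) + σ = (1 + K * i : ℤ) * X0 + d * (K * j : ℤ) * Y0 := by
      push_cast
      rw [← hz3, ← hz4, ← hz1, ← hz2, ← hz5, ← hz6, hK]
      push_cast
      field_simp
      rw [hX0]; ring
    rw [hA, hB]
    exact_mod_cast this
  have e1 : (x0 : ℝ) + b * y0 + σ = X0 := by rw [hX0]; push_cast; ring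
  have e2 : (h : ℝ) * y0 + τ = Y0 := by rw [hY0]; push_cast; ring
  rw [ey, ex, e1, e2]
  constructor
  · linear_combination (- B * Y0) * hss
  · linear_combination (- B * Y0) * hss

theorem irr_lemma (d : ℤ) (hd0 : 0 < d) (hd : ¬ IsSquare d) (u v : ℚ) (h : (u : ℝ) + v / √d = 0) :
    u = 0 ∧ v = 0 := by
  have hdR : (0 : ℝ) < d := by exact_mod_cast hd0
  have hs : 0 < √(d : ℝ) := Real.sqrt_pos.2 hdR
  have hss : √(d : ℝ) * √d = d := Real.mul_self_sqrt hdR.le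
  have h1 : (u : ℝ) * √d + v = 0 := by field_simp at h; linarith
  have hu : u = 0 := by
    by_contra hu
    apply hd
    have h2 : (u : ℝ) ^ 2 * d = v ^ 2 := by
      linear_combination (-(u : ℝ) ^ 2) * hss + (u * √d - v) * h1
    have h3 : u ^ 2 * d = v ^ 2 := by exact_mod_cast h2
    have : IsSquare (d : ℚ) := ⟨v / u, by field_simp; linarith⟩
    exact Rat.isSquare_intCast_iff.1 this
  subst hu
  exact ⟨rfl, by simpa using h1⟩

theorem orbit_lead {f : ℤ → ℤ → ℝ} (d : ℤ) (hd0 : 0 < d) (hd : ¬ IsSquare d) (b h σ τ : ℚ) (hh : h ≠ 0)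
    (c t3 t2 t1 t0 p q p' e k g : ℝ)
    (hf : ∀ x y : ℤ, ∀ X Y : ℝ, X = x + b * y + σ → Y = h * y + τ → f x y = c * (X ^ 2 - d * Y ^ 2) ^ 2
      + t3 * X ^ 3 + t2 * (X ^ 2 * Y) + t1 * (X * Y ^ 2) + t0 * Y ^ 3
      + p * X ^ 2 + q * (X * Y) + p' * Y ^ 2 + e * X + k * Y + g)
    (h0 : ∀ x y, 0 ≤ f x y) (x0 y0 : ℤ) (w w' : ℝ) (hw : w = (x0 + b * y0 + σ) + √d * (h * y0 + τ))
    (hw' : w' = (x0 + b * y0 + σ) - √d * (h * y0 + τ)) (R : ℝ) :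
    ∃ η > R, 0 < η ∧ 0 ≤ ((t3 + t1 / d) + (t2 + t0 / d) / √d) * w ^ 3 / 8 * η ^ 3
      + (p + q / √d + p' / d) * w ^ 2 / 4 * η ^ 2
      + ((3 * t3 + t2 / √d - t1 / d - 3 * t0 / d / √d) * w ^ 2 * w' / 8 + (e + k / √d) * w / 2) * η
      + (c * (w * w') ^ 2 + (2 * p - 2 * p' / d) * w * w' / 4 + g)
      + ((3 * t3 - t2 / √d - t1 / d + 3 * t0 / d / √d) * w * w' ^ 2 / 8 + (e - k / √d) * w' / 2) * η⁻¹
      + (p - q / √d + p' / d) * w' ^ 2 / 4 * η⁻¹ ^ 2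
      + ((t3 + t1 / d) - (t2 + t0 / d) / √d) * w' ^ 3 / 8 * η⁻¹ ^ 3 := by
  obtain ⟨η, hη, hη0, x, y, h1, h2⟩ := pell_orbit d hd0 hd b h σ τ hh x0 y0 R
  refine ⟨η, hη, hη0, ?_⟩
  have hdR : (0 : ℝ) < d := by exact_mod_cast hd0
  rw [← hw] at h1
  rw [← hw'] at h2
  have hs : 0 < √(d : ℝ) := Real.sqrt_pos.2 hdR
  have hss : (d : ℝ) = √(d : ℝ) ^ 2 := by rw [sq]; exact (Real.mul_self_sqrt hdR.le).symm
  have key := h0 x y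
  rw [hf x y ((η * w + η⁻¹ * w') / 2) ((η * w - η⁻¹ * w') / (2 * √d)) (by linarith)
    (by rw [← h1, ← h2]; field_simp; ring)] at key
  generalize √(d : ℝ) = s at *
  rw [hss] at key ⊢
  refine key.trans_eq ?_
  field_simp
  ring

set_option maxHeartbeats 1000000 in
theorem thin_hyp {f : ℤ → ℤ → ℝ} (θ θ' κ κ' k C : ℝ) (hne : θ ≠ θ') (hk : 0 < k) (hC : 0 ≤ C)
    (hf : ∀ x y : ℤ, ∀ w w' : ℝ, w = x + θ * y + κ → w' = x + θ' * y + κ' →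
      k * ((w * w') ^ 2 + w ^ 2 + w' ^ 2) - C ≤ f x y) :
    Thin f (fun x y => |(x + θ * y + κ : ℝ)| ≤ |(x + θ' * y + κ' : ℝ)|) := by
  have hk' : 0 < k / (1 + C) := by positivity
  set K := 1 + 1 / (k / (1 + C)) with hK
  have hK1 : 1 ≤ K := by rw [hK]; simp; positivity
  have hK0 : 0 ≤ K := by linarith
  set D := |θ - θ'| with hD
  have hD0 : 0 < D := abs_pos.2 (sub_ne_zero.2 hne)
  set c1 := (2 * K + |κ - κ'|) / D with hc1
  set c2 := K + |κ| + 1 with hc2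
  have hc10 : 0 ≤ c1 := by positivity
  have hc20 : 0 ≤ c2 := by positivity
  refine Thin.box (fun _ y => y) (fun x y => x + ⌊θ * y⌋) (fun i j => f (j - ⌊θ * i⌋) i) (c1 + c2)
    (fun x y _ => by simp) ?_
  intro M hM x y hS hle
  obtain ⟨w, hw⟩ : ∃ w : ℝ, w = x + θ * y + κ := ⟨_, rfl⟩
  obtain ⟨w', hw'⟩ : ∃ w : ℝ, w = x + θ' * y + κ' := ⟨_, rfl⟩
  rw [← hw, ← hw'] at hS
  have key := hf x y w w' hw hw'
  have hM4 : 1 ≤ M ^ 4 := one_le_pow₀ hM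
  have hM2 : 1 ≤ M ^ 2 := one_le_pow₀ hM
  have key2 : k * ((w * w') ^ 2 + w ^ 2 + w' ^ 2) ≤ (1 + C) * M ^ 4 := by
    have : C ≤ C * M ^ 4 := le_mul_of_one_le_right hC hM4
    linarith only [key, hle, this]
  have b : ∀ u : ℝ, u ^ 2 ≤ (w * w') ^ 2 + w ^ 2 + w' ^ 2 → |u| ≤ K * M ^ 2 := by
    intro u hu
    apply root2 hk' hM (abs_nonneg u)
    rw [sq_abs, div_mul_eq_mul_div, div_le_iff₀ (by positivity)]
    have := mul_le_mul_of_nonneg_left hu hk.le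
    linarith only [this, key2]
  have s1 := sq_nonneg (w * w')
  have s2 := sq_nonneg w
  have s3 := sq_nonneg w'
  have b1 := b (w * w') (by linarith only [s1, s2, s3])
  have b2 := b w (by linarith only [s1, s2, s3])
  have b3 := b w' (by linarith only [s1, s2, s3])
  have b4 : |w| ≤ K * M := by
    have h1 : |w| ^ 2 ≤ (K * M) ^ 2 := by
      calc |w| ^ 2 = |w| * |w| := sq _
        _ ≤ |w| * |w'| := mul_le_mul_of_nonneg_left hS (abs_nonneg w)
        _ = |w * w'| := (abs_mul _ _).symm
        _ ≤ K * M ^ 2 := b1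
        _ ≤ K * (K * M ^ 2) := le_mul_of_one_le_left (by positivity) hK1
        _ = (K * M) ^ 2 := by ring
    exact le_of_sq_le_sq h1 (by positivity)
  left
  constructor
  · have e : |θ - θ'| * |(y : ℝ)| ≤ |w| + |w'| + |κ - κ'| := by
      rw [← abs_mul]
      have : (θ - θ') * y = w - w' - (κ - κ') := by rw [hw, hw']; ring
      rw [this]
      exact (abs_sub _ _).trans (add_le_add_left (abs_sub _ _) _)
    have e2 : |(y : ℝ)| ≤ c1 * M ^ 2 := by
      rw [hc1, div_mul_eq_mul_div, le_div_iff₀ hD0]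
      have : |κ - κ'| ≤ |κ - κ'| * M ^ 2 := le_mul_of_one_le_right (abs_nonneg _) hM2
      linarith only [this, e, b2, b3]
    have : 0 ≤ c2 * M ^ 2 := by positivity
    linarith only [this, e2]
  · have h1 := Int.fract_nonneg (θ * y : ℝ)
    have h2 := (Int.fract_lt_one (θ * y : ℝ)).le
    have h3 : ((x + ⌊(θ * y : ℝ)⌋ : ℤ) : ℝ) = w - κ - Int.fract (θ * y : ℝ) := by
      rw [Int.fract, hw]; push_cast; ring
    rw [h3]
    have h4 : |w - κ - Int.fract (θ * y : ℝ)| ≤ |w| + |κ| + |Int.fract (θ * y : ℝ)| :=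
      (abs_sub _ _).trans (add_le_add_left (abs_sub _ _) _)
    rw [abs_of_nonneg h1] at h4
    have : |κ| ≤ |κ| * M := le_mul_of_one_le_right (abs_nonneg _) hM
    have h5 : 0 ≤ c1 * M := by positivity
    rw [hc2]
    linarith only [this, h4, h5, h2, b4, hM]

theorem quad_low {c v δ l l' g S S' w w' : ℝ} (hc : 0 < c) (hδ : 0 < δ) (hS : δ ≤ S) (hS' : δ ≤ S') :
    min (c / 2) (δ / 2) * ((w * w') ^ 2 + w ^ 2 + w' ^ 2) - (v ^ 2 / (2 * c) + l ^ 2 / (2 * δ) + l' ^ 2 / (2 * δ) + |g|)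
      ≤ c * (w * w') ^ 2 + S * w ^ 2 + S' * w' ^ 2 + v * (w * w') + l * w + l' * w' + g := by
  set N := w * w'
  have m1 : min (c / 2) (δ / 2) * N ^ 2 ≤ c / 2 * N ^ 2 := mul_le_mul_of_nonneg_right (min_le_left _ _) (sq_nonneg _)
  have m2 : min (c / 2) (δ / 2) * w ^ 2 ≤ δ / 2 * w ^ 2 := mul_le_mul_of_nonneg_right (min_le_right _ _) (sq_nonneg _)
  have m3 : min (c / 2) (δ / 2) * w' ^ 2 ≤ δ / 2 * w' ^ 2 := mul_le_mul_of_nonneg_right (min_le_right _ _) (sq_nonneg _)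
  have q : ∀ a r u : ℝ, 0 < a → 0 ≤ a / 2 * u ^ 2 + r * u + r ^ 2 / (2 * a) := by
    intro a r u ha
    have : a / 2 * u ^ 2 + r * u + r ^ 2 / (2 * a) = (a * u + r) ^ 2 / (2 * a) := by field_simp; ring
    rw [this]; positivity
  have q1 := q c v N hc
  have q2 := q δ l w hδ
  have q3 := q δ l' w' hδ
  have q4 := neg_abs_le g
  have s1 := mul_le_mul_of_nonneg_right hS (sq_nonneg w)
  have s2 := mul_le_mul_of_nonneg_right hS' (sq_nonneg w')
  linarith

theorem lead_chain {A B C D E G H : ℝ} (h : ∀ R : ℝ, ∃ η > R, 0 < η ∧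
    0 ≤ A * η ^ 3 + B * η ^ 2 + C * η + D + E * η⁻¹ + G * η⁻¹ ^ 2 + H * η⁻¹ ^ 3) :
    0 ≤ A ∧ (A = 0 → 0 ≤ B) ∧ (A = 0 → B = 0 → 0 ≤ C) := by
  refine ⟨?_, ?_, ?_⟩
  · refine lead3 (A := A) (B := B) (C := C) (D := D) (E := E) (G := G) (H := H) fun R => ?_
    obtain ⟨η, h1, h2, h3⟩ := h R
    exact ⟨η, h1, h3⟩
  · intro hA
    refine lead3 (A := B) (B := C) (C := D) (D := E) (E := G) (G := H) (H := 0) fun R => ?_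
    obtain ⟨η, h1, h2, h3⟩ := h R
    refine ⟨η, h1, (mul_nonneg h3 h2.le).trans_eq ?_⟩
    rw [hA]
    field_simp
    ring
  · intro hA hB
    refine lead3 (A := C) (B := D) (C := E) (D := G) (E := H) (G := 0) (H := 0) fun R => ?_
    obtain ⟨η, h1, h2, h3⟩ := h R
    refine ⟨η, h1, (mul_nonneg (mul_nonneg h3 h2.le) h2.le).trans_eq ?_⟩
    rw [hA, hB]
    field_simp
    ring

theorem case_B1_form2 {f : ℤ → ℤ → ℝ} (d : ℤ) (hd0 : 0 < d) (hd : ¬ IsSquare d) (b h σ τ : ℚ) (hh : h ≠ 0)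
    (c p q p' e k g : ℚ) (hc : 0 < c)
    (hf : ∀ x y : ℤ, ∀ X Y : ℝ, X = x + b * y + σ → Y = h * y + τ → f x y = c * (X ^ 2 - d * Y ^ 2) ^ 2
      + p * X ^ 2 + q * (X * Y) + p' * Y ^ 2 + e * X + k * Y + g)
    (h0 : ∀ x y, 0 ≤ f x y) : Thin f (fun _ _ => True) := by
  have hcR : (0 : ℝ) < c := by exact_mod_cast hc
  have hdR : (0 : ℝ) < d := by exact_mod_cast hd0
  have hs : 0 < √(d : ℝ) := Real.sqrt_pos.2 hdR
  have hss : (d : ℝ) = √(d : ℝ) ^ 2 := by rw [sq]; exact (Real.mul_self_sqrt hdR.le).symm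
  have hhR : (h : ℝ) ≠ 0 := by exact_mod_cast hh
  -- leading behaviour along orbits
  have lead2 : ∀ (h τ q k : ℚ), h ≠ 0 → (∀ x y : ℤ, ∀ X Y : ℝ, X = x + b * y + σ → Y = h * y + τ →
      f x y = c * (X ^ 2 - d * Y ^ 2) ^ 2
      + p * X ^ 2 + q * (X * Y) + p' * Y ^ 2 + e * X + k * Y + g) → 0 ≤ (p : ℝ) + q / √d + p' / d ∧
      ((p : ℝ) + q / √d + p' / d = 0 → (e : ℝ) + k / √d = 0) := by
    intro h τ q k hh hf
    have ol := orbit_lead (f := f) d hd0 hd b h σ τ hh c 0 0 0 0 p q p' e k g (fun x y X Y hX hY => by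
      rw [hf x y X Y hX hY]; ring) h0
    set u : ℝ := σ + √d * τ with hu
    obtain ⟨n, hn⟩ := exists_nat_gt |u|
    have hn1 : 0 < (n : ℝ) + u := by have := neg_abs_le u; linarith
    have hn2 : -(n : ℝ) + u < 0 := by have := le_abs_self u; linarith
    have ol1 := ol n 0 (n + u) _ (by rw [hu]; push_cast; ring) rfl
    have ol2 := ol (-n) 0 (-n + u) _ (by rw [hu]; push_cast; ring) rfl
    obtain ⟨-, a1, a2⟩ := lead_chain ol1
    obtain ⟨-, b1, b2⟩ := lead_chain ol2
    have z : ∀ t : ℝ, ((0 : ℝ) + 0 / d + (0 + 0 / d) / √d) * t / 8 = 0 := by intro t; simp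
    refine ⟨?_, ?_⟩
    · have h4 := a1 (z _)
      have h5 : 0 < ((n : ℝ) + u) ^ 2 := by positivity
      by_contra hneg
      push Not at hneg
      nlinarith
    · intro hz
      have h4 := a2 (z _) (by rw [hz]; simp)
      have h5 := b2 (z _) (by rw [hz]; simp)
      simp only [mul_zero, zero_div, add_zero, sub_zero, zero_mul, zero_add] at h4 h5
      apply le_antisymm
      · by_contra hneg
        push Not at hneg
        nlinarith
      · by_contra hneg
        push Not at hneg
        nlinarith
  obtain ⟨P1, P2⟩ := lead2 h τ q k hh hf
  obtain ⟨M1, M2⟩ := lead2 (-h) (-τ) (-q) (-k) (neg_ne_zero.2 hh) (fun x y X Y hX hY => by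
    rw [hf x y X (-Y) hX (by rw [hY]; push_cast; ring)]; push_cast; ring)
  have hdQ : (d : ℚ) ≠ 0 := by exact_mod_cast hd0.ne'
  push_cast at M1 M2
  rcases P1.eq_or_lt with hz | hpos
  · have i1 := irr_lemma d hd0 hd (p + p' / d) q (by push_cast; linarith)
    have i2 := irr_lemma d hd0 hd e k (P2 hz.symm)
    obtain ⟨i1, hq⟩ := i1
    obtain ⟨he, hk⟩ := i2
    have hp' : p' = - d * p := by field_simp at i1; linarith
    obtain ⟨m, hm0, hm⟩ := clear_list [b, σ, h, τ]
    obtain ⟨zb, hzb⟩ := hm b (by simp)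
    obtain ⟨zσ, hzσ⟩ := hm σ (by simp)
    obtain ⟨zh, hzh⟩ := hm h (by simp)
    obtain ⟨zτ, hzτ⟩ := hm τ (by simp)
    have hmR : (0 : ℝ) < m := by exact_mod_cast hm0
    have hzbR : (m : ℝ) * b = zb := by exact_mod_cast hzb
    have hzσR : (m : ℝ) * σ = zσ := by exact_mod_cast hzσ
    have hzhR : (m : ℝ) * h = zh := by exact_mod_cast hzh
    have hzτR : (m : ℝ) * τ = zτ := by exact_mod_cast hzτ
    refine Thin.quad (fun x y => (m * x + zb * y + zσ) ^ 2 - d * (zh * y + zτ) ^ 2) (c / m ^ 4) (p / m ^ 2) g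
      (fun x y _ => ?_) (by positivity) (fun h => absurd h (by positivity))
    rw [hf x y _ _ rfl rfl, hp', hq, he, hk]
    push_cast
    rw [← hzbR, ← hzσR, ← hzhR, ← hzτR]
    field_simp
    ring
  · have hpos' : 0 < (p : ℝ) + -q / √d + p' / d := by
      rcases M1.eq_or_lt with hz | h'
      · have i1 := irr_lemma d hd0 hd (p + p' / d) (-q) (by push_cast; linarith)
        have hq : q = 0 := by linarith [i1.2]
        rw [hq] at hz hpos
        simp at hz hpos
        linarith
      · exact h'
    obtain ⟨S, hS⟩ : ∃ S, S = ((p : ℝ) + q / √d + p' / d) / 4 := ⟨_, rfl⟩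
    obtain ⟨S', hS'⟩ : ∃ S, S = ((p : ℝ) + -q / √d + p' / d) / 4 := ⟨_, rfl⟩
    have hS0 : 0 < S := by rw [hS]; linarith
    have hS0' : 0 < S' := by rw [hS']; linarith
    have fw : ∀ x y : ℤ, ∀ w w' : ℝ, w = x + (b + √d * h) * y + (σ + √d * τ) →
        w' = x + (b - √d * h) * y + (σ - √d * τ) →
        f x y = c * (w * w') ^ 2 + S * w ^ 2 + S' * w' ^ 2 + (2 * p - 2 * p' / d) / 4 * (w * w')
          + (e + k / √d) / 2 * w + (e - k / √d) / 2 * w' + g := by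
      intro x y w w' hw hw'
      rw [hf x y ((w + w') / 2) ((w - w') / (2 * √d)) (by rw [hw, hw']; ring)
        (by rw [hw, hw']; field_simp; ring), hS, hS']
      clear lead2 P1 P2 M1 M2 hpos hpos' hS hS' hw hw'
      generalize √(d : ℝ) = s at *
      rw [hss]
      field_simp
      ring
    have hδ : 0 < min S S' := lt_min hS0 hS0'
    have hne : (b : ℝ) + √d * h ≠ b - √d * h := by
      intro hh
      have : √(d : ℝ) * h = 0 := by linarith
      rcases mul_eq_zero.1 this with h | h
      · exact hs.ne' h
      · exact hhR h
    have T1 := thin_hyp (f := f) (b + √d * h) (b - √d * h) (σ + √d * τ) (σ - √d * τ)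
      (min (c / 2) (min S S' / 2)) _ hne (lt_min (by positivity) (by positivity)) (by positivity)
      (fun x y w w' hw hw' => (quad_low hcR hδ (min_le_left S S') (min_le_right S S')).trans_eq (fw x y w w' hw hw').symm)
    have T2 := thin_hyp (f := f) (b - √d * h) (b + √d * h) (σ - √d * τ) (σ + √d * τ)
      (min (c / 2) (min S S' / 2)) _ hne.symm (lt_min (by positivity) (by positivity)) (by positivity)
      (fun x y w w' hw hw' => (quad_low (v := (2 * p - 2 * p' / d) / 4) (l := (e - k / √d) / 2) (l' := (e + k / √d) / 2) (g := g)
        hcR hδ (min_le_right S S') (min_le_left S S')).trans_eq (by rw [fw x y w' w hw' hw]; ring))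
    exact (T1.or T2).mono (fun x y _ => le_total _ _)

theorem case_B1 {f : ℤ → ℤ → ℝ} (d : ℤ) (hd0 : 0 < d) (hd : ¬ IsSquare d) (b h : ℚ) (hh : h ≠ 0)
    (c t3 t2 t1 t0 p q p' e k g : ℚ) (hc : 0 < c)
    (hf : ∀ x y : ℤ, ∀ X Y : ℝ, X = x + b * y → Y = h * y → f x y = c * (X ^ 2 - d * Y ^ 2) ^ 2
      + t3 * X ^ 3 + t2 * (X ^ 2 * Y) + t1 * (X * Y ^ 2) + t0 * Y ^ 3
      + p * X ^ 2 + q * (X * Y) + p' * Y ^ 2 + e * X + k * Y + g)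
    (h0 : ∀ x y, 0 ≤ f x y) : Thin f (fun _ _ => True) := by
  have ol := orbit_lead (f := f) d hd0 hd b h 0 0 hh c t3 t2 t1 t0 p q p' e k g (fun x y X Y hX hY => by
      rw [hf x y X Y (by rw [hX]; simp) (by rw [hY]; simp)]) h0
  have ol1 := (lead_chain (ol 1 0 1 1 (by simp) (by simp))).1
  have ol2 := (lead_chain (ol (-1) 0 (-1) (-1) (by simp) (by simp))).1
  have hdQ : (d : ℚ) ≠ 0 := by exact_mod_cast hd0.ne'
  obtain ⟨i1, i2⟩ := irr_lemma d hd0 hd (t3 + t1 / d) (t2 + t0 / d) (by push_cast; linarith)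
  have ht1 : t1 = - d * t3 := by field_simp at i1; linarith
  have ht0 : t0 = - d * t2 := by field_simp at i2; linarith
  have hc' := hc.ne'
  obtain ⟨σ, hσ⟩ : ∃ σ : ℚ, t3 = 4 * c * σ := ⟨t3 / (4 * c), by field_simp⟩
  obtain ⟨τ, hτ⟩ : ∃ τ : ℚ, t2 = - (4 * c * d * τ) := ⟨-t2 / (4 * c * d), by field_simp⟩
  obtain ⟨n, hn⟩ : ∃ n : ℚ, n = σ ^ 2 - d * τ ^ 2 := ⟨_, rfl⟩
  obtain ⟨P, hP⟩ : ∃ P : ℚ, P = p - 2 * c * n - 4 * c * σ ^ 2 := ⟨_, rfl⟩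
  obtain ⟨Q, hQ⟩ : ∃ P : ℚ, P = q + 8 * c * d * σ * τ := ⟨_, rfl⟩
  obtain ⟨P', hP'⟩ : ∃ P : ℚ, P = p' + 2 * c * n * d - 4 * c * d ^ 2 * τ ^ 2 := ⟨_, rfl⟩
  obtain ⟨E, hE⟩ : ∃ P : ℚ, P = e - 4 * c * σ * n := ⟨_, rfl⟩
  obtain ⟨K, hK⟩ : ∃ P : ℚ, P = k + 4 * c * d * τ * n := ⟨_, rfl⟩
  refine case_B1_form2 d hd0 hd b h σ τ hh c P Q P' (E - 2 * P * σ - Q * τ) (K - 2 * P' * τ - Q * σ)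
    (g - c * n ^ 2 + P * σ ^ 2 + Q * σ * τ + P' * τ ^ 2 - E * σ - K * τ) hc ?_ h0
  intro x y X Y hX hY
  rw [hf x y (X - σ) (Y - τ) (by rw [hX]; ring) (by rw [hY]; ring), hE, hK, hP, hP', hQ, ht1, ht0, hσ, hτ, hn]
  push_cast
  ring

/-- The quartic form is a rational multiple of the square of an irrational indefinite form. -/
theorem case_sq {f : ℤ → ℤ → ℝ} (a β γ b0 b1 b2 b3 c0 c1 c2 d0 d1 e : ℚ) (ha : 0 < a)
    (hΔ0 : 0 < β ^ 2 / 4 - γ) (hΔ : ¬ IsSquare (β ^ 2 / 4 - γ))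
    (hf : ∀ x y : ℤ, f x y = ((a * (x ^ 2 + β * (x * y) + γ * y ^ 2) ^ 2
      + b0 * x ^ 3 + b1 * (x ^ 2 * y) + b2 * (x * y ^ 2) + b3 * y ^ 3
      + c0 * x ^ 2 + c1 * (x * y) + c2 * y ^ 2 + d0 * x + d1 * y + e : ℚ) : ℝ))
    (h0 : ∀ x y, 0 ≤ f x y) : Thin f (fun _ _ => True) := by
  obtain ⟨Δ, hD⟩ : ∃ Δ : ℚ, Δ = β ^ 2 / 4 - γ := ⟨_, rfl⟩
  rw [← hD] at hΔ0 hΔ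
  have hγ : γ = β ^ 2 / 4 - Δ := by linarith
  obtain ⟨z, hz⟩ : ∃ z : ℚ, z = Δ.den := ⟨_, rfl⟩
  have hz0 : z ≠ 0 := by rw [hz]; exact_mod_cast Δ.den_ne_zero
  have hnum : (Δ.num : ℚ) = Δ * z := by rw [hz]; exact (Rat.mul_den_eq_num Δ).symm
  have hd : ((Δ.num * Δ.den : ℤ) : ℚ) = Δ * z ^ 2 := by push_cast; rw [hnum, hz]; ring
  obtain ⟨w, hw⟩ : ∃ w : ℚ, w = β / 2 * z := ⟨_, rfl⟩
  refine case_B1 (Δ.num * Δ.den) ?_ ?_ (β / 2) (1 / z) (by positivity) a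
    b0 (-3 * b0 * w + b1 * z) (3 * b0 * w ^ 2 - 2 * b1 * w * z + b2 * z ^ 2)
    (-b0 * w ^ 3 + b1 * w ^ 2 * z - b2 * w * z ^ 2 + b3 * z ^ 3)
    c0 (-2 * c0 * w + c1 * z) (c0 * w ^ 2 - c1 * w * z + c2 * z ^ 2) d0 (-d0 * w + d1 * z) e ha ?_ h0
  · have := Rat.num_pos.2 hΔ0
    have := Δ.den_pos
    positivity
  · rintro ⟨r, hr⟩
    apply hΔ
    refine ⟨r / z, ?_⟩
    have : ((Δ.num * Δ.den : ℤ) : ℚ) = r * r := by rw [hr]; push_cast; ring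
    rw [hd] at this
    field_simp
    linarith
  · intro x y X Y hX hY
    have hzR : (z : ℝ) ≠ 0 := by exact_mod_cast hz0
    have hdR : ((Δ.num * Δ.den : ℤ) : ℝ) = Δ * z ^ 2 := by exact_mod_cast hd
    have hy : (y : ℝ) = z * Y := by rw [hY]; push_cast; field_simp
    have hx : (x : ℝ) = X - w * Y := by rw [hX, hw, hY]; push_cast; field_simp; ring
    rw [hf, hdR]
    push_cast
    rw [hx, hy, hγ, hw]
    push_cast
    ring

theorem dir_lemma {f : ℤ → ℤ → ℝ} {a0 a1 a2 a3 a4 b0 b1 b2 b3 c0 c1 c2 d0 d1 e : ℚ}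
    (hf : ∀ x y : ℤ, f x y = ((a0 * x ^ 4 + a1 * (x ^ 3 * y) + a2 * (x ^ 2 * y ^ 2) + a3 * (x * y ^ 3) + a4 * y ^ 4
      + b0 * x ^ 3 + b1 * (x ^ 2 * y) + b2 * (x * y ^ 2) + b3 * y ^ 3
      + c0 * x ^ 2 + c1 * (x * y) + c2 * y ^ 2 + d0 * x + d1 * y + e : ℚ) : ℝ))
    (h0 : ∀ x y, 0 ≤ f x y) (u v : ℤ) :
    0 ≤ a0 * u ^ 4 + a1 * (u ^ 3 * v) + a2 * (u ^ 2 * v ^ 2) + a3 * (u * v ^ 3) + a4 * v ^ 4 ∧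
    (a0 * u ^ 4 + a1 * (u ^ 3 * v) + a2 * (u ^ 2 * v ^ 2) + a3 * (u * v ^ 3) + a4 * v ^ 4 = 0 →
      b0 * u ^ 3 + b1 * (u ^ 2 * v) + b2 * (u * v ^ 2) + b3 * v ^ 3 = 0) := by
  have := poly4 (B := 0) (p4 := ((a0 * u ^ 4 + a1 * (u ^ 3 * v) + a2 * (u ^ 2 * v ^ 2) + a3 * (u * v ^ 3) + a4 * v ^ 4 : ℚ) : ℝ))
    (p3 := ((b0 * u ^ 3 + b1 * (u ^ 2 * v) + b2 * (u * v ^ 2) + b3 * v ^ 3 : ℚ) : ℝ))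
    (p2 := ((c0 * u ^ 2 + c1 * (u * v) + c2 * v ^ 2 : ℚ) : ℝ)) (p1 := ((d0 * u + d1 * v : ℚ) : ℝ)) (p0 := ((e : ℚ) : ℝ))
    (fun t => by
      have h := h0 (t * u) (t * v)
      rw [hf] at h
      refine h.trans_eq ?_
      push_cast
      ring)
  obtain ⟨h1, h2⟩ := this
  refine ⟨by exact_mod_cast h1, fun hz => ?_⟩
  exact_mod_cast (h2 (by exact_mod_cast hz)).1

theorem case_I {f : ℤ → ℤ → ℝ} (a1 a2 a3 a4 b0 b1 b2 b3 c0 c1 c2 d0 d1 e : ℚ)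
    (hf : ∀ x y : ℤ, f x y = ((0 * x ^ 4 + a1 * (x ^ 3 * y) + a2 * (x ^ 2 * y ^ 2) + a3 * (x * y ^ 3) + a4 * y ^ 4
      + b0 * x ^ 3 + b1 * (x ^ 2 * y) + b2 * (x * y ^ 2) + b3 * y ^ 3
      + c0 * x ^ 2 + c1 * (x * y) + c2 * y ^ 2 + d0 * x + d1 * y + e : ℚ) : ℝ))
    (h0 : ∀ x y, 0 ≤ f x y) (hs : ∀ n : ℕ, ∃ x y, f x y = n) : False := by
  have D := dir_lemma hf h0
  have hb0 : b0 = 0 := by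
    have := (D 1 0).2 (by simp)
    simpa using this
  have P := poly4 (B := 0) (p4 := 0) (p3 := (a1 : ℝ)) (p2 := (a2 : ℝ)) (p1 := (a3 : ℝ)) (p0 := (a4 : ℝ)) (fun t => by
    have := (D t 1).1
    have h : (0 : ℝ) ≤ ((0 * t ^ 4 + a1 * (t ^ 3 * (1 : ℤ)) + a2 * (t ^ 2 * (1 : ℤ) ^ 2) + a3 * (t * (1 : ℤ) ^ 3) + a4 * (1 : ℤ) ^ 4 : ℚ) : ℝ) := by
      exact_mod_cast this
    refine h.trans_eq ?_
    push_cast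
    ring)
  obtain ⟨ha1, ha2, ha3⟩ := P.2 rfl
  have ha1 : a1 = 0 := by exact_mod_cast ha1
  subst hb0 ha1
  rcases ha2.eq_or_lt with hz | hpos
  · have ha3 := ha3 hz.symm
    have hz : a2 = 0 := by exact_mod_cast hz.symm
    have ha3q : a3 = 0 := by exact_mod_cast ha3
    subst hz ha3q
    have hy : ∀ y : ℤ, (0 : ℝ) ≤ b1 * y + c0 := by
      intro y
      have := poly4 (B := 0) (p4 := 0) (p3 := 0) (p2 := (b1 * y + c0 : ℝ)) (p1 := (b2 * y ^ 2 + c1 * y + d0 : ℝ))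
        (p0 := (a4 * y ^ 4 + b3 * y ^ 3 + c2 * y ^ 2 + d1 * y + e : ℝ)) (fun t => by
          have := h0 t y
          rw [hf] at this
          refine this.trans_eq ?_
          push_cast
          ring)
      exact (this.2 rfl).2.1
    have hb1 := poly4 (B := 0) (p4 := 0) (p3 := 0) (p2 := 0) (p1 := (b1 : ℝ)) (p0 := (c0 : ℝ)) (fun t => by
      have := hy t
      linarith)
    have hb1 : b1 = 0 := by exact_mod_cast (hb1.2 rfl).2.2 rfl
    subst hb1
    refine case_B2c (f := f) a4 b2 b3 c0 c1 c2 d0 d1 e ?_ h0 hs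
    intro x y
    rw [hf]
    push_cast
    ring
  · have hpos' : 0 < a2 := by exact_mod_cast hpos
    obtain ⟨r, hr⟩ : ∃ r : ℚ, r = -a3 / (2 * a2) := ⟨_, rfl⟩
    have ha3 : a3 = -2 * a2 * r := by rw [hr]; field_simp
    obtain ⟨V, hV⟩ : ∃ V : ℚ, a4 = V + a2 * r ^ 2 := ⟨a4 - a2 * r ^ 2, by ring⟩
    have hm0 : r.den ≠ 0 := r.den_ne_zero
    have hmQ : (r.den : ℚ) ≠ 0 := by exact_mod_cast hm0
    have hmp : (0 : ℚ) < r.den := by exact_mod_cast r.den_pos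
    have hnum : (r.num : ℚ) = r * r.den := (Rat.mul_den_eq_num r).symm
    have D1 := D r.num r.den
    push_cast at D1
    have hF : 0 * (r.num : ℚ) ^ 4 + 0 * (r.num ^ 3 * r.den) + a2 * (r.num ^ 2 * r.den ^ 2) + a3 * (r.num * r.den ^ 3)
        + a4 * r.den ^ 4 = V * r.den ^ 4 := by
      rw [hnum, ha3, hV]; ring
    rw [hF] at D1
    have hV0 : 0 ≤ V := by
      have : (0 : ℚ) < r.den ^ 4 := by positivity
      exact nonneg_of_mul_nonneg_left D1.1 this
    rcases hV0.eq_or_lt with hVz | hVp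
    · have hc := D1.2 (by rw [← hVz]; simp)
      rw [hnum] at hc
      have hc : b1 * r ^ 2 + b2 * r + b3 = 0 := by
        have : (b1 * r ^ 2 + b2 * r + b3) * (r.den : ℚ) ^ 3 = 0 := by rw [← hc]; ring
        rcases mul_eq_zero.1 this with h | h
        · exact h
        · exact absurd h (by positivity)
      have hb3 : b3 = - b1 * r ^ 2 - b2 * r := by linarith
      obtain ⟨m, hm⟩ : ∃ m : ℚ, m = r.den := ⟨_, rfl⟩
      rw [← hm] at hmp
      have hmR : (0 : ℝ) < m := by exact_mod_cast hmp
      refine Thin.contra (thin_B2b (f := f) r.den r.num (by exact_mod_cast hm0) (a2 / m ^ 2) (b1 / m ^ 2)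
        ((2 * b1 * r + b2) / m) (c0 / m ^ 2) ((2 * c0 * r + c1) / m) (c0 * r ^ 2 + c1 * r + c2) (d0 / m) (d0 * r + d1) e
        (by positivity) ?_ h0) hs
      intro x y X hX
      have hXR : (X : ℝ) = m * x - r * m * y := by
        rw [hX]
        push_cast
        have h1 : ((r.num : ℤ) : ℝ) = r * m := by rw [hm]; exact_mod_cast hnum
        have h2 : ((r.den : ℕ) : ℝ) = m := by rw [hm]; simp
        rw [h1, h2]
      have hx : (x : ℝ) = X / m + r * y := by rw [hXR]; field_simp; ring
      rw [hf]
      push_cast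
      rw [hx, ha3, hV, ← hVz, hb3]
      push_cast
      field_simp
      ring
    · have hVR : (0 : ℝ) < V := by exact_mod_cast hVp
      refine Thin.contra (thin_B2a (f := f) a2 a3 a4 b1 b2 b3 c0 c1 c2 d0 d1 e
        (min (a2 / 2) (V / (2 * r ^ 2 + 1))) (lt_min (by positivity) (by positivity)) ?_ ?_ h0) hs
      · intro x y
        have e1 : (a2 * x ^ 2 + a3 * (x * y) + a4 * y ^ 2 : ℝ) = a2 * (x - r * y) ^ 2 + V * y ^ 2 := by
          rw [ha3, hV]; push_cast; ring
        rw [e1]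
        set k := min ((a2 : ℝ) / 2) (V / (2 * r ^ 2 + 1)) with hk
        have hk0 : 0 < k := lt_min (by positivity) (by positivity)
        have k1 : k * 2 ≤ a2 := by have := min_le_left ((a2 : ℝ) / 2) (V / (2 * r ^ 2 + 1)); linarith
        have k2 : k * (2 * r ^ 2 + 1) ≤ V := by
          have := min_le_right ((a2 : ℝ) / 2) (V / (2 * r ^ 2 + 1))
          rwa [le_div_iff₀ (by positivity)] at this
        have e2 : x ^ 2 + y ^ 2 ≤ 2 * (x - r * y) ^ 2 + (2 * r ^ 2 + 1) * y ^ 2 := by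
          nlinarith [sq_nonneg (x - 2 * r * y)]
        have m1 := mul_le_mul_of_nonneg_left e2 hk0.le
        have m2 := mul_le_mul_of_nonneg_right k1 (sq_nonneg (x - r * y))
        have m3 := mul_le_mul_of_nonneg_right k2 (sq_nonneg y)
        linarith
      · intro x y
        rw [hf]
        push_cast
        ring

theorem case_unimod {f : ℤ → ℤ → ℝ} (a0 a1 a2 a3 a4 b0 b1 b2 b3 c0 c1 c2 d0 d1 e : ℚ)
    (hf : ∀ x y : ℤ, f x y = ((a0 * x ^ 4 + a1 * (x ^ 3 * y) + a2 * (x ^ 2 * y ^ 2) + a3 * (x * y ^ 3) + a4 * y ^ 4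
      + b0 * x ^ 3 + b1 * (x ^ 2 * y) + b2 * (x * y ^ 2) + b3 * y ^ 3
      + c0 * x ^ 2 + c1 * (x * y) + c2 * y ^ 2 + d0 * x + d1 * y + e : ℚ) : ℝ))
    (h0 : ∀ x y, 0 ≤ f x y) (hs : ∀ n : ℕ, ∃ x y, f x y = n)
    (u v s t : ℤ) (hdet : u * t - v * s = 1)
    (hz : a0 * u ^ 4 + a1 * (u ^ 3 * v) + a2 * (u ^ 2 * v ^ 2) + a3 * (u * v ^ 3) + a4 * v ^ 4 = 0) : False := by
  refine case_I (f := fun x y => f (u * x + s * y) (v * x + t * y))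
    (a0 * 4 * u ^ 3 * s + a1 * u ^ 3 * t + a1 * 3 * u ^ 2 * s * v + a2 * 2 * u ^ 2 * v * t + a2 * 2 * u * s * v ^ 2 + a3 * 3 * u * v ^ 2 * t + a3 * s * v ^ 3 + a4 * 4 * v ^ 3 * t)
    (a0 * 6 * u ^ 2 * s ^ 2 + a1 * 3 * u ^ 2 * s * t + a1 * 3 * u * s ^ 2 * v + a2 * u ^ 2 * t ^ 2 + a2 * 4 * u * s * v * t + a2 * s ^ 2 * v ^ 2 + a3 * 3 * u * v * t ^ 2 + a3 * 3 * s * v ^ 2 * t + a4 * 6 * v ^ 2 * t ^ 2)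
    (a0 * 4 * u * s ^ 3 + a1 * 3 * u * s ^ 2 * t + a1 * s ^ 3 * v + a2 * 2 * u * s * t ^ 2 + a2 * 2 * s ^ 2 * v * t + a3 * u * t ^ 3 + a3 * 3 * s * v * t ^ 2 + a4 * 4 * v * t ^ 3)
    (a0 * s ^ 4 + a1 * s ^ 3 * t + a2 * s ^ 2 * t ^ 2 + a3 * s * t ^ 3 + a4 * t ^ 4)
    (b0 * u ^ 3 + b1 * u ^ 2 * v + b2 * u * v ^ 2 + b3 * v ^ 3)
    (b0 * 3 * u ^ 2 * s + b1 * u ^ 2 * t + b1 * 2 * u * s * v + b2 * 2 * u * v * t + b2 * s * v ^ 2 + b3 * 3 * v ^ 2 * t)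
    (b0 * 3 * u * s ^ 2 + b1 * 2 * u * s * t + b1 * s ^ 2 * v + b2 * u * t ^ 2 + b2 * 2 * s * v * t + b3 * 3 * v * t ^ 2)
    (b0 * s ^ 3 + b1 * s ^ 2 * t + b2 * s * t ^ 2 + b3 * t ^ 3)
    (c0 * u ^ 2 + c1 * u * v + c2 * v ^ 2)
    (c0 * 2 * u * s + c1 * u * t + c1 * s * v + c2 * 2 * v * t)
    (c0 * s ^ 2 + c1 * s * t + c2 * t ^ 2)
    (d0 * u + d1 * v)
    (d0 * s + d1 * t) e ?_ (fun x y => h0 _ _) ?_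
  · intro x y
    rw [hf, ← hz]
    push_cast
    ring
  · intro n
    obtain ⟨x, y, h⟩ := hs n
    refine ⟨t * x - s * y, u * y - v * x, ?_⟩
    rw [← h]
    show f _ _ = f _ _
    congr 1
    · linear_combination x * hdet
    · linear_combination y * hdet

theorem case_root {f : ℤ → ℤ → ℝ} (a0 a1 a2 a3 a4 b0 b1 b2 b3 c0 c1 c2 d0 d1 e : ℚ)
    (hf : ∀ x y : ℤ, f x y = ((a0 * x ^ 4 + a1 * (x ^ 3 * y) + a2 * (x ^ 2 * y ^ 2) + a3 * (x * y ^ 3) + a4 * y ^ 4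
      + b0 * x ^ 3 + b1 * (x ^ 2 * y) + b2 * (x * y ^ 2) + b3 * y ^ 3
      + c0 * x ^ 2 + c1 * (x * y) + c2 * y ^ 2 + d0 * x + d1 * y + e : ℚ) : ℝ))
    (h0 : ∀ x y, 0 ≤ f x y) (hs : ∀ n : ℕ, ∃ x y, f x y = n)
    (r : ℚ) (hz : a0 * r ^ 4 + a1 * r ^ 3 + a2 * r ^ 2 + a3 * r + a4 = 0) : False := by
  have hc : IsCoprime r.num (r.den : ℤ) := by
    rw [Int.isCoprime_iff_gcd_eq_one]
    exact r.reduced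
  obtain ⟨α, β, h⟩ := hc
  have hnum : (r.num : ℚ) = r * r.den := (Rat.mul_den_eq_num r).symm
  refine case_unimod a0 a1 a2 a3 a4 b0 b1 b2 b3 c0 c1 c2 d0 d1 e hf h0 hs r.num r.den (-β) α (by linarith) ?_
  push_cast
  rw [hnum]
  linear_combination (r.den : ℚ) ^ 4 * hz

theorem posdef_bound (a0 a1 a2 a3 a4 : ℝ) (ha : 0 < a0)
    (hg : ∀ r : ℝ, 0 < a0 * r ^ 4 + a1 * r ^ 3 + a2 * r ^ 2 + a3 * r + a4) :
    ∃ k > 0, ∀ x y : ℝ, k * (x ^ 2 + y ^ 2) ^ 2 ≤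
      a0 * x ^ 4 + a1 * (x ^ 3 * y) + a2 * (x ^ 2 * y ^ 2) + a3 * (x * y ^ 3) + a4 * y ^ 4 := by
  let F : ℝ × ℝ → ℝ := fun p => a0 * p.1 ^ 4 + a1 * (p.1 ^ 3 * p.2) + a2 * (p.1 ^ 2 * p.2 ^ 2)
    + a3 * (p.1 * p.2 ^ 3) + a4 * p.2 ^ 4
  have hF : Continuous F := by fun_prop
  have hpos : ∀ p : ℝ × ℝ, p.1 ^ 2 + p.2 ^ 2 = 1 → 0 < F p := by
    rintro ⟨x, y⟩ h
    simp only at h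
    by_cases hy : y = 0
    · subst hy
      have hx : x ^ 2 = 1 := by linarith
      have : F (x, 0) = a0 * (x ^ 2) ^ 2 := by simp only [F]; ring
      rw [this, hx]; linarith
    · have : F (x, y) = y ^ 4 * (a0 * (x / y) ^ 4 + a1 * (x / y) ^ 3 + a2 * (x / y) ^ 2 + a3 * (x / y) + a4) := by
        simp only [F]; field_simp
      rw [this]
      have : 0 < y ^ 4 := by positivity
      exact mul_pos this (hg _)
  let S : Set (ℝ × ℝ) := {p | p.1 ^ 2 + p.2 ^ 2 = 1}
  have hS : IsCompact S := by
    refine (isCompact_closedBall (0 : ℝ × ℝ) 1).of_isClosed_subset ?_ ?_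
    · exact isClosed_eq (by fun_prop) continuous_const
    · rintro ⟨x, y⟩ h
      have h : x ^ 2 + y ^ 2 = 1 := h
      rw [mem_closedBall_zero_iff, Prod.norm_def]
      apply max_le
      · show |x| ≤ 1
        exact abs_le_one_iff_mul_self_le_one.2 (by nlinarith)
      · show |y| ≤ 1
        exact abs_le_one_iff_mul_self_le_one.2 (by nlinarith)
  obtain ⟨p, hp, hmin⟩ := hS.exists_isMinOn ⟨(1, 0), by simp [S]⟩ hF.continuousOn
  refine ⟨F p, hpos p hp, fun x y => ?_⟩
  by_cases hz : x ^ 2 + y ^ 2 = 0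
  · have hx : x = 0 := by nlinarith [sq_nonneg x, sq_nonneg y]
    have hy : y = 0 := by nlinarith [sq_nonneg x, sq_nonneg y]
    simp [hx, hy]
  · have hz' : 0 < x ^ 2 + y ^ 2 := lt_of_le_of_ne (by positivity) (Ne.symm hz)
    set s := √(x ^ 2 + y ^ 2) with hs
    have hs0 : 0 < s := Real.sqrt_pos.2 hz'
    have hs2 : s ^ 2 = x ^ 2 + y ^ 2 := Real.sq_sqrt hz'.le
    have hm : F p ≤ F (x / s, y / s) := hmin (by
      show (x / s) ^ 2 + (y / s) ^ 2 = 1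
      rw [div_pow, div_pow, ← add_div, ← hs2]; field_simp)
    have e1 : F (x / s, y / s) * (s ^ 2) ^ 2 =
        a0 * x ^ 4 + a1 * (x ^ 3 * y) + a2 * (x ^ 2 * y ^ 2) + a3 * (x * y ^ 3) + a4 * y ^ 4 := by
      simp only [F]; field_simp
    rw [← hs2, ← e1]
    exact mul_le_mul_of_nonneg_right hm (by positivity)

open Polynomial in
theorem sq_of_root (a0 a1 a2 a3 a4 : ℚ) (ha : 0 < a0) (r : ℝ) (hr : Irrational r)
    (hg : (a0 : ℝ) * r ^ 4 + a1 * r ^ 3 + a2 * r ^ 2 + a3 * r + a4 = 0)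
    (hg' : (4 * a0 : ℝ) * r ^ 3 + 3 * a1 * r ^ 2 + 2 * a2 * r + a3 = 0) :
    ∃ β γ : ℚ, a1 = 2 * a0 * β ∧ a2 = a0 * (β ^ 2 + 2 * γ) ∧ a3 = 2 * a0 * β * γ ∧ a4 = a0 * γ ^ 2 ∧
      0 < β ^ 2 / 4 - γ ∧ ¬ IsSquare (β ^ 2 / 4 - γ) := by
  let G : ℚ[X] := C a0 * X ^ 4 + C a1 * X ^ 3 + C a2 * X ^ 2 + C a3 * X + C a4
  have hdeg : G.natDegree = 4 := by
    simp only [G]; compute_degree!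
    exact ha.ne'
  have hG0 : G ≠ 0 := by
    intro h; rw [h] at hdeg; simp at hdeg
  have hGr : aeval r G = 0 := by
    simp only [G, map_add, map_mul, map_pow, aeval_X, aeval_C]; simpa using hg
  have hGr' : aeval r (derivative G) = 0 := by
    simp only [G, derivative_mul, derivative_C, derivative_X_pow, derivative_X,
      map_add, map_mul, map_pow, aeval_X, aeval_C]
    simp
    linarith
  have hint : IsIntegral ℚ r := by
    rw [← isAlgebraic_iff_isIntegral]
    exact ⟨G, hG0, hGr⟩
  set m := minpoly ℚ r with hm
  have hirr : Irreducible m := minpoly.irreducible hint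
  have hmon : m.Monic := minpoly.monic hint
  have hmr : aeval r m = 0 := minpoly.aeval ℚ r
  have hsep : IsCoprime m (derivative m) := hirr.separable
  obtain ⟨H, hH⟩ := minpoly.dvd ℚ r hGr
  have hdv' : m ∣ derivative G := minpoly.dvd ℚ r hGr'
  have hmH : m ∣ H := by
    rw [hH, derivative_mul] at hdv'
    have h1 : m ∣ derivative m * H := (dvd_add_left (dvd_mul_right m _)).1 hdv'
    exact hsep.dvd_of_dvd_mul_left h1
  obtain ⟨K, hK⟩ := hmH
  have hGm : G = m * (m * K) := by rw [hH, hK]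
  have hK0 : K ≠ 0 := by rintro rfl; apply hG0; rw [hGm]; simp
  have hm0 : m ≠ 0 := hmon.ne_zero
  have hd : 4 = m.natDegree + (m.natDegree + K.natDegree) := by
    rw [← hdeg, hGm, natDegree_mul hm0 (mul_ne_zero hm0 hK0), natDegree_mul hm0 hK0]
  have hd0 : 0 < m.natDegree := minpoly.natDegree_pos hint
  have hd1 : m.natDegree ≠ 1 := by
    intro h1
    have hmx : m = X + C (m.coeff 0) := hmon.eq_X_add_C h1
    rw [hmx] at hmr
    simp at hmr
    apply hr
    exact ⟨-m.coeff 0, by push_cast; linarith⟩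
  have hm2 : m.natDegree = 2 := by omega
  have hK1 : K.natDegree = 0 := by omega
  obtain ⟨κ, hκ⟩ := natDegree_eq_zero.1 hK1
  obtain ⟨β, hβ⟩ : ∃ β, β = m.coeff 1 := ⟨_, rfl⟩
  obtain ⟨γ, hγ⟩ : ∃ β, β = m.coeff 0 := ⟨_, rfl⟩
  have hmx : m = X ^ 2 + C β * X + C γ := by
    have := hmon.as_sum
    rw [hm2] at this
    simp only [Finset.sum_range_succ, Finset.sum_range_zero, ← hβ, ← hγ] at this
    rw [this]
    simp
    ring
  have ev : ∀ x : ℚ, a0 * x ^ 4 + a1 * x ^ 3 + a2 * x ^ 2 + a3 * x + a4 = κ * (x ^ 2 + β * x + γ) ^ 2 := by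
    intro x
    have h1 : eval x G = eval x (m * (m * K)) := by rw [hGm]
    rw [← hκ, hmx] at h1
    simp only [G, eval_add, eval_mul, eval_pow, eval_X, eval_C] at h1
    rw [h1]; ring
  have e0 := ev 0
  have e1 := ev 1
  have e2 := ev (-1)
  have e3 := ev 2
  have e4 := ev (-2)
  have hκ0 : a0 = κ := by linarith
  subst hκ0
  have hreal : (r + β / 2) ^ 2 = ((β ^ 2 / 4 - γ : ℚ) : ℝ) := by
    rw [hmx] at hmr
    simp only [map_add, map_mul, map_pow, aeval_X, aeval_C] at hmr
    simp at hmr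
    push_cast
    linarith
  have hnsq : ¬ IsSquare (β ^ 2 / 4 - γ) := by
    rintro ⟨s, hs⟩
    rw [hs] at hreal
    push_cast at hreal
    have : (r + β / 2 - s) * (r + β / 2 + s) = 0 := by linarith
    rcases mul_eq_zero.1 this with h | h
    · exact hr ⟨s - β / 2, by push_cast; linarith⟩
    · exact hr ⟨-s - β / 2, by push_cast; linarith⟩
  refine ⟨β, γ, by linarith, by linarith, by linarith, by linarith, ?_, hnsq⟩
  have h1 : (0 : ℝ) ≤ ((β ^ 2 / 4 - γ : ℚ) : ℝ) := by rw [← hreal]; positivity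
  have h2 : 0 ≤ β ^ 2 / 4 - γ := by exact_mod_cast h1
  rcases h2.eq_or_lt with h | h
  · exact absurd ⟨0, by rw [← h]; simp⟩ hnsq
  · exact h

theorem main_real {f : ℤ → ℤ → ℝ} (a0 a1 a2 a3 a4 b0 b1 b2 b3 c0 c1 c2 d0 d1 e : ℚ)
    (hf : ∀ x y : ℤ, f x y = ((a0 * x ^ 4 + a1 * (x ^ 3 * y) + a2 * (x ^ 2 * y ^ 2) + a3 * (x * y ^ 3) + a4 * y ^ 4
      + b0 * x ^ 3 + b1 * (x ^ 2 * y) + b2 * (x * y ^ 2) + b3 * y ^ 3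
      + c0 * x ^ 2 + c1 * (x * y) + c2 * y ^ 2 + d0 * x + d1 * y + e : ℚ) : ℝ))
    (h0 : ∀ x y, 0 ≤ f x y) (hs : ∀ n : ℕ, ∃ x y, f x y = n) : False := by
  by_cases ha : a0 = 0
  · subst ha
    exact case_I a1 a2 a3 a4 b0 b1 b2 b3 c0 c1 c2 d0 d1 e hf h0 hs
  have D := dir_lemma hf h0
  have hpos : 0 < a0 := by
    refine lt_of_le_of_ne ?_ (Ne.symm ha)
    have := (D 1 0).1
    simpa using this
  by_cases hroot : ∃ r : ℚ, a0 * r ^ 4 + a1 * r ^ 3 + a2 * r ^ 2 + a3 * r + a4 = 0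
  · obtain ⟨r, hr⟩ := hroot
    exact case_root a0 a1 a2 a3 a4 b0 b1 b2 b3 c0 c1 c2 d0 d1 e hf h0 hs r hr
  have hQ : ∀ r : ℚ, 0 ≤ a0 * r ^ 4 + a1 * r ^ 3 + a2 * r ^ 2 + a3 * r + a4 := by
    intro r
    have h := (D r.num r.den).1
    push_cast at h
    rw [(Rat.mul_den_eq_num r).symm] at h
    have h4 : (0 : ℚ) < r.den ^ 4 := by have : (0 : ℚ) < r.den := by exact_mod_cast r.den_pos
                                        positivity
    refine nonneg_of_mul_nonneg_left (h.trans_eq ?_) h4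
    ring
  let g : ℝ → ℝ := fun r => a0 * r ^ 4 + a1 * r ^ 3 + a2 * r ^ 2 + a3 * r + a4
  have hR : ∀ r : ℝ, 0 ≤ g r := by
    intro r
    refine Rat.isDenseEmbedding_coe_real.dense.induction_on (p := fun r => 0 ≤ g r) r ?_ ?_
    · exact isClosed_le continuous_const (by fun_prop)
    · intro q
      have := hQ q
      simp only [g]
      exact_mod_cast this
  by_cases hreal : ∃ r : ℝ, g r = 0
  · obtain ⟨r, hr⟩ := hreal
    have hirr : Irrational r := by
      rintro ⟨q, rfl⟩
      apply hroot
      refine ⟨q, ?_⟩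
      simp only [g] at hr
      exact_mod_cast hr
    have hder : HasDerivAt g (a0 * (4 * r ^ 3) + a1 * (3 * r ^ 2) + a2 * (2 * r) + a3) r := by
      have h1 := ((hasDerivAt_pow 4 r).const_mul (a0 : ℝ)).add ((hasDerivAt_pow 3 r).const_mul (a1 : ℝ))
      have h2 := (h1.add ((hasDerivAt_pow 2 r).const_mul (a2 : ℝ))).add ((hasDerivAt_id r).const_mul (a3 : ℝ))
      have h3 := h2.add_const (a4 : ℝ)
      have h4 : HasDerivAt g _ r := h3
      exact h4.congr_deriv (by norm_num)
    have hmin : IsLocalMin g r := Filter.Eventually.of_forall fun x => by rw [hr]; exact hR x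
    have hz := hmin.hasDerivAt_eq_zero hder
    obtain ⟨β, γ, e1, e2, e3, e4, h5, h6⟩ := sq_of_root a0 a1 a2 a3 a4 hpos r hirr hr (by linarith)
    refine Thin.contra (case_sq (f := f) a0 β γ b0 b1 b2 b3 c0 c1 c2 d0 d1 e hpos h5 h6 ?_ h0) hs
    intro x y
    rw [hf, e1, e2, e3, e4]
    congr 1
    ring
  · have hgp : ∀ r : ℝ, 0 < g r := fun r => lt_of_le_of_ne (hR r) (fun h => hreal ⟨r, h.symm⟩)
    obtain ⟨k, hk, hb⟩ := posdef_bound a0 a1 a2 a3 a4 (by exact_mod_cast hpos) hgp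
    refine Thin.contra (thin_posdef (f := f) _ b0 b1 b2 b3 c0 c1 c2 d0 d1 e k hk hb ?_) hs
    intro x y
    rw [hf]
    push_cast
    ring

/-- The linear map picking the value of `F` out of its fifteen coefficients. -/
theorem eval_expand (F : MvPolynomial (Fin 2) ℚ) (hF : F.totalDegree ≤ 4) :
    ∃ a0 a1 a2 a3 a4 b0 b1 b2 b3 c0 c1 c2 d0 d1 e : ℚ, ∀ x y : ℚ,
      MvPolynomial.eval ![x, y] F =
      a0 * x ^ 4 + a1 * (x ^ 3 * y) + a2 * (x ^ 2 * y ^ 2) + a3 * (x * y ^ 3) + a4 * y ^ 4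
      + b0 * x ^ 3 + b1 * (x ^ 2 * y) + b2 * (x * y ^ 2) + b3 * y ^ 3
      + c0 * x ^ 2 + c1 * (x * y) + c2 * y ^ 2 + d0 * x + d1 * y + e := by
  let c : ℕ → ℕ → ℚ := fun i j => F.coeff (Finsupp.single 0 i + Finsupp.single 1 j)
  refine ⟨c 4 0, c 3 1, c 2 2, c 1 3, c 0 4, c 3 0, c 2 1, c 1 2, c 0 3, c 2 0, c 1 1, c 0 2, c 1 0, c 0 1, c 0 0, ?_⟩
  intro x y
  have hc : ∀ i j, 4 < i + j → c i j = 0 := by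
    intro i j hij
    apply MvPolynomial.coeff_eq_zero_of_totalDegree_lt
    refine lt_of_le_of_lt hF ?_
    have : (Finsupp.single (0 : Fin 2) i + Finsupp.single 1 j).degree = i + j := by
      rw [map_add, Finsupp.degree_single, Finsupp.degree_single]
    exact hij.trans_eq this.symm
  have key : MvPolynomial.eval ![x, y] F = ∑ p ∈ Finset.range 5 ×ˢ Finset.range 5, c p.1 p.2 * (x ^ p.1 * y ^ p.2) := by
    rw [MvPolynomial.eval_eq']
    refine Finset.sum_bij_ne_zero (fun s _ _ => (s 0, s 1)) ?_ ?_ ?_ ?_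
    · intro s hs hne
      have h1 : s.degree ≤ 4 := (MvPolynomial.le_totalDegree hs).trans hF
      have h2 : s.degree = s 0 + s 1 := by rw [Finsupp.degree_eq_sum]; simp
      simp
      omega
    · intro s _ _ t _ _ h
      simp at h
      ext i
      fin_cases i
      · exact h.1
      · exact h.2
    · rintro ⟨i, j⟩ hp hne
      have hcne : c i j ≠ 0 := fun h => hne (by simp [h])
      refine ⟨Finsupp.single 0 i + Finsupp.single 1 j, MvPolynomial.mem_support_iff.2 hcne, ?_, ?_⟩
      · simpa using hne
      · simp
    · intro s hs hne
      have : s = Finsupp.single 0 (s 0) + Finsupp.single 1 (s 1) := by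
        ext i
        fin_cases i <;> simp
      simp only [c, ← this]
      simp
  rw [key, Finset.sum_product]
  simp only [Finset.sum_range_succ, Finset.sum_range_zero]
  rw [hc 1 4 (by norm_num), hc 2 3 (by norm_num), hc 2 4 (by norm_num), hc 3 2 (by norm_num), hc 3 3 (by norm_num),
    hc 3 4 (by norm_num), hc 4 1 (by norm_num), hc 4 2 (by norm_num), hc 4 3 (by norm_num), hc 4 4 (by norm_num)]
  ring

/-- There does not exist a polynomial `F ∈ ℚ[x,y]` of total degree 4
such that `F(ℤ²) = ℤ_{≥0}`. -/
theorem no_quartic_represents_all_nonneg_integers :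
    ¬ ∃ F : MvPolynomial (Fin 2) ℚ, F.totalDegree = 4 ∧
      {q : ℚ | ∃ x y : ℤ, MvPolynomial.eval ![(x : ℚ), (y : ℚ)] F = q}
        = {q : ℚ | ∃ n : ℕ, q = (n : ℚ)} := by
  rintro ⟨F, hdeg, hset⟩
  obtain ⟨a0, a1, a2, a3, a4, b0, b1, b2, b3, c0, c1, c2, d0, d1, e, h⟩ := eval_expand F hdeg.le
  refine main_real (f := fun x y => ((MvPolynomial.eval ![(x : ℚ), (y : ℚ)] F : ℚ) : ℝ))
    a0 a1 a2 a3 a4 b0 b1 b2 b3 c0 c1 c2 d0 d1 e (fun x y => ?_) (fun x y => ?_) (fun n => ?_)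
  · exact congrArg (fun q : ℚ => (q : ℝ)) (h x y)
  · have hm : MvPolynomial.eval ![(x : ℚ), (y : ℚ)] F ∈ {q : ℚ | ∃ n : ℕ, q = (n : ℚ)} := by
      rw [← hset]; exact ⟨x, y, rfl⟩
    obtain ⟨n, hn⟩ := hm
    simp only [hn]
    positivity
  · have hm : (n : ℚ) ∈ {q : ℚ | ∃ x y : ℤ, MvPolynomial.eval ![(x : ℚ), (y : ℚ)] F = q} := by
      rw [hset]; exact ⟨n, rfl⟩
    obtain ⟨x, y, hxy⟩ := hm
    refine ⟨x, y, ?_⟩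
    simp only [hxy]
    simp
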